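/- arXiv:1507.04332 — 3 statements merged into one kernel-verified Lean document; each statement's English description precedes it below -/
import Mathlib

section
/- Let n ∈ ℕ, 1 < p < ∞ with np > d, and let Ω ⊂ ℝ^d be a Sobolev extension domain. Then W^{n,p}(Ω) is a multiplicative algebra: for every f, g ∈ W^{n,p}(Ω) one has f·g ∈ W^{n,p}(Ω) with ‖f g‖_{W^{n,p}(Ω)} ≤ C ‖f‖_{W^{n,p}(Ω)} ‖g‖_{W^{n,p}(Ω)}, where C depends only on d, n, p and Ω. -/
open MeasureTheory Filter Set
open scoped ENNReal NNReal RealInnerProductSpace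

noncomputable section

variable {d : ℕ}

/-- Smooth test functions compactly supported inside `Ω ⊆ ℝ^d`. -/
def TestOnR (Ω : Set (EuclideanSpace ℝ (Fin d))) (φ : EuclideanSpace ℝ (Fin d) → ℝ) : Prop :=
  ContDiff ℝ (⊤ : ℕ∞) φ ∧ HasCompactSupport φ ∧ tsupport φ ⊆ Ω

/-- `g` is the weak partial derivative of `f` in the `i`-th coordinate direction in `Ω`. -/
def IsWeakPartialR (Ω : Set (EuclideanSpace ℝ (Fin d))) (i : Fin d)
    (f g : EuclideanSpace ℝ (Fin d) → ℝ) : Prop :=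
  ∀ φ : EuclideanSpace ℝ (Fin d) → ℝ, TestOnR Ω φ →
    ∫ x in Ω, f x * fderiv ℝ φ x (EuclideanSpace.single i 1) = - ∫ x in Ω, g x * φ x

/-- `D` is a family of weak derivatives of `f` in `Ω` indexed by multiindices, up to order `n`. -/
def IsWeakDerivFamilyR (Ω : Set (EuclideanSpace ℝ (Fin d))) (n : ℕ)
    (f : EuclideanSpace ℝ (Fin d) → ℝ)
    (D : (Fin d → ℕ) → EuclideanSpace ℝ (Fin d) → ℝ) : Prop :=
  D 0 = f ∧
  (∀ α : Fin d → ℕ, (∑ i, α i) ≤ n → AEStronglyMeasurable (D α) (volume.restrict Ω)) ∧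
  (∀ α : Fin d → ℕ, (∑ i, α i) < n → ∀ i : Fin d,
    IsWeakPartialR Ω i (D α) (D (α + Pi.single i 1)))

/-- Multiindices in `d` variables of total order at most `n`. -/
def multiIdx (d n : ℕ) : Finset (Fin d → ℕ) :=
  (Fintype.piFinset fun _ : Fin d => Finset.range (n + 1)).filter fun α => ∑ i, α i ≤ n

/-- The `W^{n,p}(Ω)` norm of a family of derivatives. -/
def famNormR (n : ℕ) (p : ℝ) (Ω : Set (EuclideanSpace ℝ (Fin d)))
    (D : (Fin d → ℕ) → EuclideanSpace ℝ (Fin d) → ℝ) : ℝ≥0∞ :=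
  ∑ α ∈ multiIdx d n, eLpNorm (D α) (ENNReal.ofReal p) (volume.restrict Ω)

/-- The `W^{n,p}(Ω)` (Sobolev) norm of `f` (it is `∞` when `f ∉ W^{n,p}(Ω)`). -/
def sobNormR (n : ℕ) (p : ℝ) (Ω : Set (EuclideanSpace ℝ (Fin d)))
    (f : EuclideanSpace ℝ (Fin d) → ℝ) : ℝ≥0∞ :=
  ⨅ (D : (Fin d → ℕ) → EuclideanSpace ℝ (Fin d) → ℝ)
    (_ : IsWeakDerivFamilyR Ω n f D), famNormR n p Ω D

/-- Membership in the Sobolev space `W^{n,p}(Ω)`, `Ω ⊆ ℝ^d`. -/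
def MemSobolevR (n : ℕ) (p : ℝ) (Ω : Set (EuclideanSpace ℝ (Fin d)))
    (f : EuclideanSpace ℝ (Fin d) → ℝ) : Prop :=
  sobNormR n p Ω f < ⊤

/-- `Ω` is a Sobolev `W^{n,p}` extension domain. -/
def IsExtensionDomain (n : ℕ) (p : ℝ) (Ω : Set (EuclideanSpace ℝ (Fin d))) : Prop :=
  ∃ (Ext : (EuclideanSpace ℝ (Fin d) → ℝ) → EuclideanSpace ℝ (Fin d) → ℝ) (C : ℝ≥0∞),
    C ≠ ⊤ ∧ ∀ f, MemSobolevR n p Ω f →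
      (Ext f =ᵐ[volume.restrict Ω] f) ∧
      sobNormR n p Set.univ (Ext f) ≤ C * sobNormR n p Ω f

/-- `Ω ⊆ ℝ^d` is a Lipschitz domain with character `(δ, R)`: near every boundary point,
`Ω` is the region above the graph of a `δ`-Lipschitz function. -/
def IsLipschitzDomainWithR (Ω : Set (EuclideanSpace ℝ (Fin d))) (δ : ℝ≥0) (R : ℝ) : Prop :=
  IsOpen Ω ∧ IsConnected Ω ∧ Bornology.IsBounded Ω ∧ 0 < R ∧
  ∀ x ∈ frontier Ω, ∃ v : EuclideanSpace ℝ (Fin d), ‖v‖ = 1 ∧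
    ∃ A : EuclideanSpace ℝ (Fin d) → ℝ, LipschitzWith δ A ∧
      ∀ w ∈ Metric.ball x R, (w ∈ Ω ↔ A (w - x - ⟪w - x, v⟫ • v) < ⟪w - x, v⟫)

/-- `Ω ⊆ ℝ^d` is a bounded Lipschitz domain. -/
def IsLipschitzDomainR (Ω : Set (EuclideanSpace ℝ (Fin d))) : Prop :=
  ∃ δ R, IsLipschitzDomainWithR Ω δ R

end

noncomputable section

section Averages

variable {d : ℕ}

/-- Jensen's inequality for the power function and a finite measure. -/
theorem lintegral_rpow_le_measure_univ_mul {α : Type*} [MeasurableSpace α] (ν : Measure α)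
    {r : ℝ} (hr : 1 ≤ r) {g : α → ℝ≥0∞} (hg : AEMeasurable g ν) :
    (∫⁻ a, g a ∂ν) ^ r ≤ ν univ ^ (r - 1) * ∫⁻ a, g a ^ r ∂ν := by
  have h := eLpNorm'_le_eLpNorm'_mul_rpow_measure_univ (f := g) (μ := ν) one_pos hr
    hg.aestronglyMeasurable
  simp only [eLpNorm', enorm_eq_self, ENNReal.rpow_one, div_one] at h
  have hr0 : 0 < r := by linarith
  calc (∫⁻ a, g a ∂ν) ^ r
      ≤ ((∫⁻ a, g a ^ r ∂ν) ^ (1 / r) * ν univ ^ (1 - 1 / r)) ^ r :=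
        ENNReal.rpow_le_rpow h hr0.le
    _ = ν univ ^ (r - 1) * ∫⁻ a, g a ^ r ∂ν := by
        rw [ENNReal.mul_rpow_of_nonneg _ _ hr0.le, ← ENNReal.rpow_mul, ← ENNReal.rpow_mul,
          mul_comm]
        congr 2
        · field_simp
        · rw [one_div_mul_cancel hr0.ne', ENNReal.rpow_one]

/-- A weak form of Minkowski's integral inequality, for a finite measure in the inner variable. -/
theorem lintegral_lintegral_rpow_le {α β : Type*} [MeasurableSpace α] [MeasurableSpace β]
    (μ : Measure α) (ν : Measure β) [SFinite μ] [IsFiniteMeasure ν] {r : ℝ} (hr : 1 ≤ r)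
    {G : α → β → ℝ≥0∞} (hG : Measurable (Function.uncurry G)) :
    ∫⁻ x, (∫⁻ y, G x y ∂ν) ^ r ∂μ ≤ ν univ ^ (r - 1) * ∫⁻ y, ∫⁻ x, G x y ^ r ∂μ ∂ν := by
  calc ∫⁻ x, (∫⁻ y, G x y ∂ν) ^ r ∂μ
      ≤ ∫⁻ x, ν univ ^ (r - 1) * ∫⁻ y, G x y ^ r ∂ν ∂μ := lintegral_mono fun x =>
        lintegral_rpow_le_measure_univ_mul ν hr (hG.of_uncurry_left (x := x)).aemeasurable
    _ = ν univ ^ (r - 1) * ∫⁻ x, ∫⁻ y, G x y ^ r ∂ν ∂μ :=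
        lintegral_const_mul _ (Measurable.lintegral_prod_right (hG.pow_const r))
    _ = _ := by rw [lintegral_lintegral_swap (hG.pow_const r).aemeasurable]

/-- The uniform probability measure on the unit ball. -/
def unitBallMeasure (d : ℕ) : Measure (EuclideanSpace ℝ (Fin d)) :=
  ProbabilityTheory.cond volume (Metric.ball 0 1)

instance isProbabilityMeasure_unitBallMeasure : IsProbabilityMeasure (unitBallMeasure d) :=
  ProbabilityTheory.cond_isProbabilityMeasure_of_finite
    (Metric.measure_ball_pos volume _ one_pos).ne' measure_ball_lt_top.ne

theorem ae_unitBallMeasure_norm_le : ∀ᵐ y ∂unitBallMeasure d, ‖y‖ ≤ 1 := by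
  refine Measure.ae_smul_measure ?_ _
  filter_upwards [ae_restrict_mem Metric.isOpen_ball.measurableSet] with y hy
  simpa using (mem_ball_zero_iff.1 hy).le

/-- The average of `h` over the ball of radius `t` around `x`. -/
def ballAvg (t : ℝ) (h : EuclideanSpace ℝ (Fin d) → ℝ≥0∞) (x : EuclideanSpace ℝ (Fin d)) : ℝ≥0∞ :=
  ∫⁻ y, h (x - t • y) ∂unitBallMeasure d

/-- The average of `ballAvg t h` over the radii `t ∈ (0, 1)`. -/
def radialAvg (h : EuclideanSpace ℝ (Fin d) → ℝ≥0∞) (x : EuclideanSpace ℝ (Fin d)) : ℝ≥0∞ :=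
  ∫⁻ t in Ioo (0 : ℝ) 1, ballAvg t h x

theorem measurable_ballAvg {h : EuclideanSpace ℝ (Fin d) → ℝ≥0∞} (hh : Measurable h) :
    Measurable fun z : EuclideanSpace ℝ (Fin d) × ℝ => ballAvg z.2 h z.1 := by
  unfold ballAvg
  refine Measurable.lintegral_prod_right
    (f := fun (z : EuclideanSpace ℝ (Fin d) × ℝ) y => h (z.1 - z.2 • y)) ?_
  exact hh.comp (by fun_prop)

theorem lintegral_comp_sub_smul {h : EuclideanSpace ℝ (Fin d) → ℝ≥0∞} (hh : Measurable h)
    (x : EuclideanSpace ℝ (Fin d)) {t : ℝ} (ht : 0 < t) :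
    ∫⁻ y, h (x - t • y) = ENNReal.ofReal (t ^ (-(d : ℝ))) * ∫⁻ y, h y := by
  have hm : Measurable fun y => h (x - y) := hh.comp (measurable_const.sub measurable_id)
  rw [← lintegral_map (f := fun y => h (x - y)) (g := fun y => t • y) hm (measurable_const_smul t),
    Measure.map_addHaar_smul _ ht.ne', lintegral_smul_measure, lintegral_sub_left_eq_self,
    finrank_euclideanSpace_fin, abs_of_pos (by positivity), Real.rpow_neg ht.le,
    Real.rpow_natCast, smul_eq_mul]

theorem ballAvg_rpow_le {h : EuclideanSpace ℝ (Fin d) → ℝ≥0∞} (hh : Measurable h)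
    (x : EuclideanSpace ℝ (Fin d)) {t r : ℝ} (ht : 0 < t) (hr : 1 ≤ r) :
    ballAvg t h x ^ r ≤ (volume (Metric.ball (0 : EuclideanSpace ℝ (Fin d)) 1))⁻¹ *
      (ENNReal.ofReal (t ^ (-(d : ℝ))) * ∫⁻ y, h y ^ r) := by
  have hm : Measurable fun y => h (x - t • y) := hh.comp (by fun_prop)
  calc ballAvg t h x ^ r ≤ ∫⁻ y, h (x - t • y) ^ r ∂unitBallMeasure d := by
        simpa [ballAvg] using
          lintegral_rpow_le_measure_univ_mul (unitBallMeasure d) hr hm.aemeasurable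
    _ ≤ (volume (Metric.ball (0 : EuclideanSpace ℝ (Fin d)) 1))⁻¹ *
          ∫⁻ y, h (x - t • y) ^ r := by
        rw [unitBallMeasure, ProbabilityTheory.cond, lintegral_smul_measure, smul_eq_mul]
        gcongr
        exact Measure.restrict_le_self
    _ = _ := by rw [lintegral_comp_sub_smul (hh.pow_const r) x ht]

theorem lintegral_ballAvg_rpow_le {h : EuclideanSpace ℝ (Fin d) → ℝ≥0∞} (hh : Measurable h)
    (t : ℝ) {r : ℝ} (hr : 1 ≤ r) : ∫⁻ x, ballAvg t h x ^ r ≤ ∫⁻ x, h x ^ r := by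
  have := lintegral_lintegral_rpow_le (volume : Measure (EuclideanSpace ℝ (Fin d)))
    (unitBallMeasure d) hr (G := fun x y => h (x - t • y)) (hh.comp (by fun_prop))
  simpa [ballAvg, lintegral_sub_right_eq_self (fun x => h x ^ r)] using this

/-- The averaging operator `radialAvg` gains integrability from `L^{1/s}` to `L^{1/(s - σ)}` as
long as `d σ < 1`. -/
theorem exists_eLpNorm_radialAvg_le (d : ℕ) {s σ : ℝ} (hs : 0 < s) (hs1 : s ≤ 1) (hσ : 0 ≤ σ)
    (hσs : σ ≤ s) (hσd : d * σ < 1) :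
    ∃ C : ℝ≥0∞, C ≠ ⊤ ∧ ∀ h : EuclideanSpace ℝ (Fin d) → ℝ≥0∞, Measurable h →
      eLpNorm (radialAvg h) (ENNReal.ofReal (s - σ))⁻¹ volume ≤
        C * eLpNorm h (ENNReal.ofReal s)⁻¹ volume := by
  set c := (volume (Metric.ball (0 : EuclideanSpace ℝ (Fin d)) 1))⁻¹ with hc
  have hctop : c ≠ ⊤ := ENNReal.inv_ne_top.2 (Metric.measure_ball_pos volume _ one_pos).ne'
  set w : ℝ → ℝ≥0∞ := fun t => ENNReal.ofReal (t ^ (-(d * σ))) with hw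
  have hwm : Measurable w := by fun_prop
  set ν := (volume.restrict (Ioo (0 : ℝ) 1)).withDensity w with hν
  have hV : ν univ ≠ ⊤ := by
    rw [hν, withDensity_apply _ MeasurableSet.univ, Measure.restrict_univ]
    have : IntegrableOn (fun t : ℝ => t ^ (-(d * σ))) (Ioo 0 1) :=
      (intervalIntegral.integrableOn_Ioo_rpow_iff one_pos).2 (by linarith)
    exact this.lintegral_lt_top.ne
  have : IsFiniteMeasure ν := ⟨hV.lt_top⟩
  refine ⟨c ^ σ * ν univ, ENNReal.mul_ne_top (ENNReal.rpow_ne_top_of_nonneg hσ hctop) hV,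
    fun h hh => ?_⟩
  have hr : 1 ≤ s⁻¹ := (one_le_inv₀ hs).2 hs1
  set N := (∫⁻ y, h y ^ s⁻¹) ^ s with hN
  have hNorm : eLpNorm h (ENNReal.ofReal s)⁻¹ volume = N := by
    rw [eLpNorm_eq_lintegral_rpow_enorm_toReal (by simp) (by simpa using hs)]
    simp [ENNReal.toReal_inv, ENNReal.toReal_ofReal hs.le, hN]
  set θ := σ / s with hθ
  have hθ0 : 0 ≤ θ := by positivity
  have hθ1 : θ ≤ 1 := (div_le_one hs).2 hσs
  have hpt : ∀ x, ∀ t ∈ Ioo (0 : ℝ) 1,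
      ballAvg t h x ≤ (c ^ σ * N ^ θ) * (w t * ballAvg t h x ^ (1 - θ)) := by
    intro x t ht
    have h1 : ballAvg t h x ^ θ ≤ c ^ σ * (w t * N ^ θ) := by
      have := ENNReal.rpow_le_rpow (ballAvg_rpow_le hh x ht.1 hr) hσ
      rw [← ENNReal.rpow_mul, ENNReal.mul_rpow_of_nonneg _ _ hσ, ENNReal.mul_rpow_of_nonneg _ _ hσ,
        ENNReal.ofReal_rpow_of_pos (Real.rpow_pos_of_pos ht.1 _), ← Real.rpow_mul ht.1.le] at this
      rw [hN, ← ENNReal.rpow_mul, hw]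
      convert this using 3
      · rw [hθ, div_eq_inv_mul]
      · ring_nf
      · rw [hθ]; field_simp
    calc ballAvg t h x = ballAvg t h x ^ θ * ballAvg t h x ^ (1 - θ) := by
          rw [← ENNReal.rpow_add_of_nonneg _ _ hθ0 (by linarith)]; simp
      _ ≤ c ^ σ * (w t * N ^ θ) * ballAvg t h x ^ (1 - θ) := by gcongr
      _ = _ := by ring
  have hbm : ∀ x, Measurable fun t => ballAvg t h x := fun x =>
    (measurable_ballAvg hh).comp (measurable_const.prodMk measurable_id)
  have hJ : ∀ x, radialAvg h x ≤ (c ^ σ * N ^ θ) * ∫⁻ t, ballAvg t h x ^ (1 - θ) ∂ν := by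
    intro x
    rw [hν, lintegral_withDensity_eq_lintegral_mul _ hwm ((hbm x).pow_const _),
      ← lintegral_const_mul _ (hwm.mul ((hbm x).pow_const _))]
    exact setLIntegral_mono (((hwm.mul ((hbm x).pow_const _))).const_mul _) (hpt x)
  rw [hNorm]
  rcases hσs.eq_or_lt with rfl | hlt
  · have hθ1 : θ = 1 := div_self hs.ne'
    rw [sub_self, ENNReal.ofReal_zero, ENNReal.inv_zero, eLpNorm_exponent_top]
    refine eLpNormEssSup_le_of_ae_enorm_bound (Eventually.of_forall fun x => ?_)
    refine (hJ x).trans (le_of_eq ?_)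
    simp [hθ1]
    ring
  · have hu : 0 < s - σ := by linarith
    have hq : 1 ≤ (s - σ)⁻¹ := (one_le_inv₀ hu).2 (by linarith)
    have hexp : (1 - θ) * (s - σ)⁻¹ = s⁻¹ := by rw [hθ]; field_simp
    have hνV : ν univ ^ ((s - σ)⁻¹ - 1) * ν univ = ν univ ^ (s - σ)⁻¹ := by
      conv_lhs => rw [← ENNReal.rpow_one (ν univ), ← ENNReal.rpow_mul, one_mul]
      rw [← ENNReal.rpow_add_of_nonneg _ _ (by linarith) zero_le_one, sub_add_cancel]
    have key : ∫⁻ x, radialAvg h x ^ (s - σ)⁻¹ ≤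
        (c ^ σ * N ^ θ) ^ (s - σ)⁻¹ * (ν univ ^ (s - σ)⁻¹ * ∫⁻ y, h y ^ s⁻¹) := by
      calc ∫⁻ x, radialAvg h x ^ (s - σ)⁻¹
          ≤ ∫⁻ x, (c ^ σ * N ^ θ) ^ (s - σ)⁻¹ * (∫⁻ t, ballAvg t h x ^ (1 - θ) ∂ν) ^ (s - σ)⁻¹ :=
            lintegral_mono fun x => by
              rw [← ENNReal.mul_rpow_of_nonneg _ _ (by positivity)]
              exact ENNReal.rpow_le_rpow (hJ x) (by positivity)
        _ = (c ^ σ * N ^ θ) ^ (s - σ)⁻¹ * ∫⁻ x, (∫⁻ t, ballAvg t h x ^ (1 - θ) ∂ν) ^ (s - σ)⁻¹ := by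
            refine lintegral_const_mul _ (Measurable.pow_const ?_ _)
            exact Measurable.lintegral_prod_right (f := fun x t => ballAvg t h x ^ (1 - θ))
              ((measurable_ballAvg hh).pow_const _)
        _ ≤ (c ^ σ * N ^ θ) ^ (s - σ)⁻¹ * (ν univ ^ ((s - σ)⁻¹ - 1) *
              ∫⁻ t, (∫⁻ x, (ballAvg t h x ^ (1 - θ)) ^ (s - σ)⁻¹) ∂ν) := by
            gcongr
            exact lintegral_lintegral_rpow_le volume ν hq (G := fun x t => ballAvg t h x ^ (1 - θ))
              ((measurable_ballAvg hh).pow_const _)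
        _ ≤ (c ^ σ * N ^ θ) ^ (s - σ)⁻¹ * (ν univ ^ ((s - σ)⁻¹ - 1) *
              ∫⁻ _, (∫⁻ y, h y ^ s⁻¹) ∂ν) := by
            gcongr (c ^ σ * N ^ θ) ^ (s - σ)⁻¹ * (ν univ ^ ((s - σ)⁻¹ - 1) * ?_)
            refine lintegral_mono fun t => ?_
            simp_rw [← ENNReal.rpow_mul, hexp]
            exact lintegral_ballAvg_rpow_le hh t hr
        _ = _ := by
            rw [lintegral_const, mul_comm (∫⁻ y, h y ^ s⁻¹), ← mul_assoc (ν univ ^ _), hνV]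
    rw [eLpNorm_eq_lintegral_rpow_enorm_toReal (by simp) (by simpa using hlt)]
    simp only [ENNReal.toReal_inv, ENNReal.toReal_ofReal hu.le, enorm_eq_self, one_div, inv_inv]
    refine (ENNReal.rpow_le_rpow key hu.le).trans (le_of_eq ?_)
    rw [ENNReal.mul_rpow_of_nonneg _ _ hu.le, ENNReal.mul_rpow_of_nonneg _ _ hu.le,
      ENNReal.rpow_inv_rpow hu.ne', ENNReal.rpow_inv_rpow hu.ne']
    have : (∫⁻ y, h y ^ s⁻¹) ^ (s - σ) = N ^ (1 - θ) := by
      rw [hN, ← ENNReal.rpow_mul]; congr 1; rw [hθ]; field_simp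
    rw [this]
    calc c ^ σ * N ^ θ * (ν univ * N ^ (1 - θ)) = c ^ σ * ν univ * (N ^ θ * N ^ (1 - θ)) := by ring
      _ = _ := by rw [← ENNReal.rpow_add_of_nonneg _ _ hθ0 (by linarith)]; simp

end Averages

section SobolevStep

variable {d : ℕ}

theorem radialAvg_add {f g : EuclideanSpace ℝ (Fin d) → ℝ≥0∞} (hf : Measurable f)
    (x : EuclideanSpace ℝ (Fin d)) :
    radialAvg (fun y => f y + g y) x = radialAvg f x + radialAvg g x := by
  have h1 : ∀ t : ℝ, ballAvg t (fun y => f y + g y) x = ballAvg t f x + ballAvg t g x := fun t =>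
    lintegral_add_left (hf.comp (by fun_prop)) _
  simp only [radialAvg, h1]
  exact lintegral_add_left ((measurable_ballAvg hf).comp (measurable_const.prodMk measurable_id)) _

theorem enorm_apply_le_sum (L : EuclideanSpace ℝ (Fin d) →L[ℝ] ℝ) {y : EuclideanSpace ℝ (Fin d)}
    (hy : ‖y‖ ≤ 1) : ‖L y‖ₑ ≤ ∑ i, ‖L (EuclideanSpace.single i 1)‖ₑ := by
  have hsum : y = ∑ i, y i • EuclideanSpace.single i (1 : ℝ) := by
    simpa using ((EuclideanSpace.basisFun (Fin d) ℝ).sum_repr y).symm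
  calc ‖L y‖ₑ = ‖∑ i, y i • L (EuclideanSpace.single i 1)‖ₑ := by
        conv_lhs => rw [hsum]
        simp only [map_sum, map_smul]
    _ ≤ ∑ i, ‖y i • L (EuclideanSpace.single i 1)‖ₑ := enorm_sum_le _ _
    _ ≤ ∑ i, ‖L (EuclideanSpace.single i 1)‖ₑ := by
        refine Finset.sum_le_sum fun i _ => ?_
        rw [enorm_smul]
        refine mul_le_of_le_one_left' ?_
        rw [← ofReal_norm, ENNReal.ofReal_le_one]
        exact (PiLp.norm_apply_le y i).trans hy

theorem enorm_le_enorm_add_lintegral {w : EuclideanSpace ℝ (Fin d) → ℝ} (hw : ContDiff ℝ 1 w)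
    (x : EuclideanSpace ℝ (Fin d)) {y : EuclideanSpace ℝ (Fin d)} (hy : ‖y‖ ≤ 1) {r : ℝ}
    (hr : r ∈ Ioo (0 : ℝ) 1) :
    ‖w x‖ₑ ≤ ‖w (x - r • y)‖ₑ +
      ∫⁻ t in Ioo (0 : ℝ) 1, ∑ i, ‖fderiv ℝ w (x - t • y) (EuclideanSpace.single i 1)‖ₑ := by
  have hderiv : ∀ t : ℝ, HasDerivAt (fun t : ℝ => w (x - t • y))
      (-(fderiv ℝ w (x - t • y) y)) t := by
    intro t
    have h1 : HasDerivAt (fun t : ℝ => x - t • y) (-y) t := by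
      simpa using ((hasDerivAt_id t).smul_const y).const_sub x
    have h2 := (hw.differentiable one_ne_zero (x - t • y)).hasFDerivAt.comp_hasDerivAt t h1
    rwa [map_neg] at h2
  have hcont : Continuous fun t : ℝ => -(fderiv ℝ w (x - t • y) y) := by
    have := hw.continuous_fderiv one_ne_zero
    fun_prop
  have hftc := intervalIntegral.integral_eq_sub_of_hasDerivAt (a := 0) (b := r)
    (fun t _ => hderiv t) (hcont.intervalIntegrable _ _)
  have hx : w x = w (x - r • y) - ∫ t in (0 : ℝ)..r, -(fderiv ℝ w (x - t • y) y) := by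
    rw [hftc]; simp
  rw [hx, intervalIntegral.integral_of_le hr.1.le]
  refine (enorm_sub_le).trans (add_le_add le_rfl ?_)
  refine (enorm_integral_le_lintegral_enorm _).trans ?_
  rw [← restrict_Ioo_eq_restrict_Ioc]
  refine (lintegral_mono_set (Ioo_subset_Ioo_right hr.2.le)).trans ?_
  refine lintegral_mono fun t => ?_
  rw [enorm_neg]
  exact enorm_apply_le_sum _ hy

theorem enorm_le_radialAvg {w : EuclideanSpace ℝ (Fin d) → ℝ} (hw : ContDiff ℝ 1 w)
    (x : EuclideanSpace ℝ (Fin d)) :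
    ‖w x‖ₑ ≤ radialAvg (fun y => ‖w y‖ₑ + ∑ i, ‖fderiv ℝ w y (EuclideanSpace.single i 1)‖ₑ) x := by
  set H : EuclideanSpace ℝ (Fin d) → ℝ≥0∞ :=
    fun y => ∑ i, ‖fderiv ℝ w y (EuclideanSpace.single i 1)‖ₑ with hH
  have hwm : Measurable fun y => ‖w y‖ₑ := hw.continuous.enorm.measurable
  have hHm : Measurable H := by
    have := hw.continuous_fderiv one_ne_zero
    refine Finset.measurable_sum _ fun i _ => Continuous.measurable ?_
    fun_prop
  rw [radialAvg_add hwm]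
  have hswap : radialAvg H x =
      ∫⁻ y, (∫⁻ t in Ioo (0 : ℝ) 1, H (x - t • y)) ∂unitBallMeasure d :=
    lintegral_lintegral_swap (hHm.comp (by fun_prop)).aemeasurable
  have hone : ∀ a : ℝ≥0∞, ∫⁻ _ in Ioo (0 : ℝ) 1, (∫⁻ _, a ∂unitBallMeasure d) = a := by simp
  rw [← hone (radialAvg H x), ← hone ‖w x‖ₑ, radialAvg, ← lintegral_add_right _ measurable_const]
  refine setLIntegral_mono ?_ fun r hr => ?_
  · exact ((measurable_ballAvg hwm).comp (measurable_const.prodMk measurable_id)).add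
      measurable_const
  rw [lintegral_const _, lintegral_const, measure_univ, mul_one, mul_one, hswap, ballAvg,
    ← lintegral_add_left (f := fun y => ‖w (x - r • y)‖ₑ) (hwm.comp (by fun_prop))]
  calc ‖w x‖ₑ = ∫⁻ _, ‖w x‖ₑ ∂unitBallMeasure d := by simp
    _ ≤ _ := lintegral_mono_ae <| by
      filter_upwards [ae_unitBallMeasure_norm_le] with y hy
      exact enorm_le_enorm_add_lintegral hw x hy hr

/-- Sobolev embedding with a gain of `σ < 1/d` in the reciprocal exponent, for `C¹` functions. -/
theorem exists_eLpNorm_le_of_contDiff (d : ℕ) {s σ : ℝ} (hs : 0 < s) (hs1 : s ≤ 1) (hσ : 0 ≤ σ)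
    (hσs : σ ≤ s) (hσd : d * σ < 1) :
    ∃ C : ℝ≥0∞, C ≠ ⊤ ∧ ∀ w : EuclideanSpace ℝ (Fin d) → ℝ, ContDiff ℝ 1 w →
      eLpNorm w (ENNReal.ofReal (s - σ))⁻¹ volume ≤
        C * (eLpNorm w (ENNReal.ofReal s)⁻¹ volume +
          ∑ i, eLpNorm (fun x => fderiv ℝ w x (EuclideanSpace.single i 1))
            (ENNReal.ofReal s)⁻¹ volume) := by
  obtain ⟨C, hC, h⟩ := exists_eLpNorm_radialAvg_le d hs hs1 hσ hσs hσd
  refine ⟨C, hC, fun w hw => ?_⟩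
  have hq : 1 ≤ (ENNReal.ofReal s)⁻¹ := by
    rw [ENNReal.one_le_inv]; exact ENNReal.ofReal_le_one.2 hs1
  have hcw := hw.continuous_fderiv one_ne_zero
  have hwm : Measurable fun y => ‖w y‖ₑ := hw.continuous.enorm.measurable
  have hdm : ∀ i, Measurable fun y => ‖fderiv ℝ w y (EuclideanSpace.single i 1)‖ₑ := fun i =>
    Continuous.measurable (by fun_prop)
  have hHm : Measurable fun y => ∑ i, ‖fderiv ℝ w y (EuclideanSpace.single i 1)‖ₑ :=
    Finset.measurable_sum _ fun i _ => hdm i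
  calc eLpNorm w (ENNReal.ofReal (s - σ))⁻¹ volume
      ≤ eLpNorm (radialAvg fun y => ‖w y‖ₑ + ∑ i, ‖fderiv ℝ w y (EuclideanSpace.single i 1)‖ₑ)
          (ENNReal.ofReal (s - σ))⁻¹ volume := eLpNorm_mono_enorm (enorm_le_radialAvg hw)
    _ ≤ C * eLpNorm (fun y => ‖w y‖ₑ + ∑ i, ‖fderiv ℝ w y (EuclideanSpace.single i 1)‖ₑ)
          (ENNReal.ofReal s)⁻¹ volume := h _ (hwm.add hHm)
    _ ≤ _ := by
        gcongr
        refine (eLpNorm_add_le hwm.aestronglyMeasurable hHm.aestronglyMeasurable hq).trans ?_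
        rw [eLpNorm_enorm]
        gcongr
        have hfun : (fun y => ∑ i, ‖fderiv ℝ w y (EuclideanSpace.single i 1)‖ₑ) =
            ∑ i, fun y => ‖fderiv ℝ w y (EuclideanSpace.single i 1)‖ₑ := by
          ext y; simp
        rw [hfun]
        refine (eLpNorm_sum_le (fun i _ => (hdm i).aestronglyMeasurable) hq).trans (le_of_eq ?_)
        exact Finset.sum_congr rfl fun i _ => eLpNorm_enorm _

end SobolevStep

section Mollification

open scoped Convolution Topology

variable {d : ℕ}

theorem eLpNorm_inv_ofReal_le_iff {α ε : Type*} [MeasurableSpace α] {μ : Measure α} [ENorm ε]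
    {s : ℝ} (hs : 0 < s) {F : α → ε} {c : ℝ≥0∞} :
    eLpNorm F (ENNReal.ofReal s)⁻¹ μ ≤ c ↔ ∫⁻ x, ‖F x‖ₑ ^ s⁻¹ ∂μ ≤ c ^ s⁻¹ := by
  rw [eLpNorm_eq_lintegral_rpow_enorm_toReal (by simp) (by simpa using hs)]
  simp only [ENNReal.toReal_inv, ENNReal.toReal_ofReal hs.le, one_div, inv_inv]
  rw [ENNReal.le_rpow_inv_iff hs]

theorem eLpNorm_le_of_enorm_le_lintegral {α β : Type*} [MeasurableSpace α] [MeasurableSpace β]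
    {μ : Measure α} {ν : Measure β} [SFinite μ] [IsProbabilityMeasure ν] {s : ℝ} (hs : 0 < s)
    (hs1 : s ≤ 1) {F : α → ℝ} {G : α → β → ℝ≥0∞} (hG : Measurable (Function.uncurry G))
    (hF : ∀ x, ‖F x‖ₑ ≤ ∫⁻ y, G x y ∂ν) {c : ℝ≥0∞}
    (hc : ∀ᵐ y ∂ν, eLpNorm (fun x => G x y) (ENNReal.ofReal s)⁻¹ μ ≤ c) :
    eLpNorm F (ENNReal.ofReal s)⁻¹ μ ≤ c := by
  have hr : 1 ≤ s⁻¹ := (one_le_inv₀ hs).2 hs1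
  rw [eLpNorm_inv_ofReal_le_iff hs]
  calc ∫⁻ x, ‖F x‖ₑ ^ s⁻¹ ∂μ ≤ ∫⁻ x, (∫⁻ y, G x y ∂ν) ^ s⁻¹ ∂μ :=
        lintegral_mono fun x => ENNReal.rpow_le_rpow (hF x) (by positivity)
    _ ≤ ∫⁻ y, ∫⁻ x, G x y ^ s⁻¹ ∂μ ∂ν := by
        simpa using lintegral_lintegral_rpow_le μ ν hr hG
    _ ≤ ∫⁻ _, c ^ s⁻¹ ∂ν := by
        refine lintegral_mono_ae ?_
        filter_upwards [hc] with y hy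
        simpa using (eLpNorm_inv_ofReal_le_iff hs).1 hy
    _ = c ^ s⁻¹ := by simp

/-- Translation is continuous in `L^p` for finite `p`. -/
theorem tendsto_eLpNorm_translate_sub {f : EuclideanSpace ℝ (Fin d) → ℝ} {p : ℝ≥0∞}
    (hp : 1 ≤ p) (hp' : p ≠ ⊤) (hf : MemLp f p volume) :
    Tendsto (fun y => eLpNorm (fun x => f (x - y) - f x) p volume) (𝓝 0) (𝓝 0) := by
  have : Fact (1 ≤ p) := ⟨hp⟩
  let g : C(EuclideanSpace ℝ (Fin d), C(EuclideanSpace ℝ (Fin d), EuclideanSpace ℝ (Fin d))) :=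
    (ContinuousMap.mk (fun a : EuclideanSpace ℝ (Fin d) × EuclideanSpace ℝ (Fin d) => a.2 - a.1)
      (by fun_prop)).curry
  have hg : ∀ y, MeasurePreserving (g y) volume volume := fun y =>
    measurePreserving_sub_right volume y
  have h := (tendsto_const_nhds (x := hf.toLp f) (f := 𝓝 (0 : EuclideanSpace ℝ (Fin d)))
    ).compMeasurePreservingLp (g.continuous.tendsto 0) hg (hg 0) hp'
  rw [Lp.tendsto_Lp_iff_tendsto_eLpNorm'] at h
  refine h.congr fun y => eLpNorm_congr_ae ?_
  have e1 := (hf.comp_measurePreserving (hg y)).coeFn_toLp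
  have e2 := (hf.comp_measurePreserving (hg 0)).coeFn_toLp
  filter_upwards [e1, e2] with x h1 h2
  simp only [Lp.toLp_compMeasurePreserving, Pi.sub_apply]
  rw [h1, h2]
  simp [g]

/-- A sequence of bump functions at the origin whose supports shrink to a point. -/
def mollBump (d k : ℕ) : ContDiffBump (0 : EuclideanSpace ℝ (Fin d)) where
  rIn := 1 / (k + 1)
  rOut := 2 * (1 / (k + 1))
  rIn_pos := by positivity
  rIn_lt_rOut := by
    have : (0 : ℝ) < 1 / (k + 1) := by positivity
    linarith

theorem tendsto_mollBump_rOut (d : ℕ) :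
    Tendsto (fun k => (mollBump d k).rOut) atTop (𝓝 0) := by
  simpa [mollBump] using (tendsto_one_div_add_atTop_nhds_zero_nat (𝕜 := ℝ)).const_mul 2

/-- The mollification of `f` at scale `1 / (k + 1)`. -/
def mollify (k : ℕ) (f : EuclideanSpace ℝ (Fin d) → ℝ) : EuclideanSpace ℝ (Fin d) → ℝ :=
  (mollBump d k).normed volume ⋆[ContinuousLinearMap.lsmul ℝ ℝ, volume] f

theorem contDiff_mollify (k : ℕ) {f : EuclideanSpace ℝ (Fin d) → ℝ}
    (hf : LocallyIntegrable f volume) : ContDiff ℝ (⊤ : ℕ∞) (mollify k f) :=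
  (mollBump d k).hasCompactSupport_normed.contDiff_convolution_left _
    (mollBump d k).contDiff_normed hf

theorem ae_tendsto_mollify {f : EuclideanSpace ℝ (Fin d) → ℝ} (hf : LocallyIntegrable f volume) :
    ∀ᵐ x, Tendsto (fun k => mollify k f x) atTop (𝓝 (f x)) :=
  ContDiffBump.ae_convolution_tendsto_right_of_locallyIntegrable (K := 2)
    (tendsto_mollBump_rOut d) (Eventually.of_forall fun _ => le_rfl) hf

/-- The probability measure with density the `k`-th mollifier. -/
def mollMeasure (d k : ℕ) : Measure (EuclideanSpace ℝ (Fin d)) :=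
  volume.withDensity fun y => ENNReal.ofReal ((mollBump d k).normed volume y)

theorem measurable_ofReal_mollBump (k : ℕ) :
    Measurable fun y => ENNReal.ofReal ((mollBump d k).normed volume y) :=
  (mollBump d k).continuous_normed.measurable.ennreal_ofReal

instance isProbabilityMeasure_mollMeasure (k : ℕ) : IsProbabilityMeasure (mollMeasure d k) where
  measure_univ := by
    rw [mollMeasure, withDensity_apply _ MeasurableSet.univ, Measure.restrict_univ,
      ← ofReal_integral_eq_lintegral_ofReal (mollBump d k).integrable_normed
        (Eventually.of_forall (mollBump d k).nonneg_normed), (mollBump d k).integral_normed,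
      ENNReal.ofReal_one]

theorem enorm_integral_normed_smul_le (k : ℕ) {u : EuclideanSpace ℝ (Fin d) → ℝ}
    (hu : Measurable u) :
    ‖∫ y, (mollBump d k).normed volume y * u y‖ₑ ≤ ∫⁻ y, ‖u y‖ₑ ∂mollMeasure d k := by
  rw [mollMeasure, lintegral_withDensity_eq_lintegral_mul _ (measurable_ofReal_mollBump k) hu.enorm]
  refine (enorm_integral_le_lintegral_enorm _).trans (lintegral_mono fun y => ?_)
  rw [enorm_mul, Real.enorm_of_nonneg ((mollBump d k).nonneg_normed y)]
  rfl

theorem ae_mollMeasure_mem_ball (k : ℕ) :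
    ∀ᵐ y ∂mollMeasure d k, y ∈ Metric.ball 0 (mollBump d k).rOut := by
  rw [mollMeasure, ae_withDensity_iff (measurable_ofReal_mollBump k)]
  refine Eventually.of_forall fun y hy => ?_
  rw [← (mollBump d k).support_normed_eq (μ := volume)]
  exact fun h => hy (by rw [h, ENNReal.ofReal_zero])

theorem eLpNorm_mollify_le (k : ℕ) {s : ℝ} (hs : 0 < s) (hs1 : s ≤ 1)
    {f : EuclideanSpace ℝ (Fin d) → ℝ} (hf : Measurable f) :
    eLpNorm (mollify k f) (ENNReal.ofReal s)⁻¹ volume ≤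
      eLpNorm f (ENNReal.ofReal s)⁻¹ volume := by
  refine eLpNorm_le_of_enorm_le_lintegral (ν := mollMeasure d k) hs hs1
    (G := fun x y => ‖f (x - y)‖ₑ) (hf.enorm.comp (by fun_prop))
    (fun x => enorm_integral_normed_smul_le k (hf.comp (by fun_prop)))
    (Eventually.of_forall fun y => ?_)
  rw [eLpNorm_enorm]
  exact (eLpNorm_comp_measurePreserving hf.aestronglyMeasurable
    (measurePreserving_sub_right volume y)).le

theorem mollify_sub_eq_integral (k : ℕ) {f : EuclideanSpace ℝ (Fin d) → ℝ}
    (hf : LocallyIntegrable f volume) (x : EuclideanSpace ℝ (Fin d)) :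
    mollify k f x - f x = ∫ y, (mollBump d k).normed volume y * (f (x - y) - f x) := by
  have h1 : Integrable fun y => (mollBump d k).normed volume y * f (x - y) :=
    (mollBump d k).hasCompactSupport_normed.convolutionExists_left
      (ContinuousLinearMap.lsmul ℝ ℝ) (mollBump d k).continuous_normed hf x
  have h2 : Integrable fun y => (mollBump d k).normed volume y * f x :=
    (mollBump d k).integrable_normed.mul_const _
  simp_rw [mul_sub]
  rw [integral_sub h1 h2, integral_mul_const, (mollBump d k).integral_normed, one_mul]
  rfl

/-- Mollifications converge in `L^p` for `1 ≤ p < ∞`. -/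
theorem tendsto_eLpNorm_mollify_sub {s : ℝ} (hs : 0 < s) (hs1 : s ≤ 1)
    {f : EuclideanSpace ℝ (Fin d) → ℝ} (hfm : Measurable f)
    (hf : MemLp f (ENNReal.ofReal s)⁻¹ volume) :
    Tendsto (fun k => eLpNorm (fun x => mollify k f x - f x) (ENNReal.ofReal s)⁻¹ volume) atTop
      (𝓝 0) := by
  have hq : 1 ≤ (ENNReal.ofReal s)⁻¹ := by
    rw [ENNReal.one_le_inv]; exact ENNReal.ofReal_le_one.2 hs1
  have hq' : (ENNReal.ofReal s)⁻¹ ≠ ⊤ := by simpa using hs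
  rw [ENNReal.tendsto_nhds_zero]
  intro ε hε
  have h1 := ENNReal.tendsto_nhds_zero.1 (tendsto_eLpNorm_translate_sub hq hq' hf) ε hε
  obtain ⟨δ, hδ, hball⟩ := Metric.eventually_nhds_iff_ball.1 h1
  filter_upwards [(tendsto_mollBump_rOut d).eventually_lt_const hδ] with k hk
  refine eLpNorm_le_of_enorm_le_lintegral (ν := mollMeasure d k) hs hs1
    (G := fun x y => ‖f (x - y) - f x‖ₑ)
    (((hfm.comp (by fun_prop)).sub (hfm.comp measurable_fst)).enorm) (fun x => ?_) ?_
  · rw [mollify_sub_eq_integral k (hf.locallyIntegrable hq)]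
    exact enorm_integral_normed_smul_le k ((hfm.comp (by fun_prop)).sub measurable_const)
  · filter_upwards [ae_mollMeasure_mem_ball k] with y hy
    rw [eLpNorm_enorm]
    exact hball y (Metric.ball_subset_ball hk.le hy)

end Mollification

section WeakDerivatives

open scoped Convolution Topology

variable {d : ℕ}

theorem isWeakPartialR_univ_iff {i : Fin d} {f g : EuclideanSpace ℝ (Fin d) → ℝ} :
    IsWeakPartialR univ i f g ↔ ∀ φ : EuclideanSpace ℝ (Fin d) → ℝ,
      ContDiff ℝ (⊤ : ℕ∞) φ → HasCompactSupport φ →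
        ∫ x, f x * fderiv ℝ φ x (EuclideanSpace.single i 1) = - ∫ x, g x * φ x := by
  simp only [IsWeakPartialR, TestOnR, Measure.restrict_univ, subset_univ, and_true, and_imp]

theorem continuous_fderiv_apply {φ : EuclideanSpace ℝ (Fin d) → ℝ} (hφ : ContDiff ℝ (⊤ : ℕ∞) φ)
    (v : EuclideanSpace ℝ (Fin d)) : Continuous fun x => fderiv ℝ φ x v :=
  (hφ.continuous_fderiv (by simp)).clm_apply continuous_const

theorem integrable_mul_of_hasCompactSupport {f ψ : EuclideanSpace ℝ (Fin d) → ℝ}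
    (hf : LocallyIntegrable f volume) (hψ : Continuous ψ) (hc : HasCompactSupport ψ) :
    Integrable fun x => f x * ψ x := by
  simpa [mul_comm] using hf.integrable_smul_left_of_hasCompactSupport hψ hc

namespace IsWeakPartialR

variable {i : Fin d} {f g f' g' : EuclideanSpace ℝ (Fin d) → ℝ}

theorem zero : IsWeakPartialR univ i 0 0 := by
  simp [isWeakPartialR_univ_iff]

theorem add (hf : LocallyIntegrable f volume) (hg : LocallyIntegrable g volume)
    (hf' : LocallyIntegrable f' volume) (hg' : LocallyIntegrable g' volume)
    (h : IsWeakPartialR univ i f g) (h' : IsWeakPartialR univ i f' g') :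
    IsWeakPartialR univ i (f + f') (g + g') := by
  rw [isWeakPartialR_univ_iff] at *
  intro φ hφ hc
  have hc' := hc.fderiv_apply (𝕜 := ℝ) (EuclideanSpace.single i 1)
  have hφ' := continuous_fderiv_apply hφ (EuclideanSpace.single i 1)
  simp only [Pi.add_apply, add_mul]
  rw [integral_add (integrable_mul_of_hasCompactSupport hf hφ' hc')
      (integrable_mul_of_hasCompactSupport hf' hφ' hc'),
    integral_add (integrable_mul_of_hasCompactSupport hg hφ.continuous hc)
      (integrable_mul_of_hasCompactSupport hg' hφ.continuous hc), h φ hφ hc, h' φ hφ hc]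
  ring

theorem const_smul (c : ℝ) (h : IsWeakPartialR univ i f g) :
    IsWeakPartialR univ i (c • f) (c • g) := by
  rw [isWeakPartialR_univ_iff] at *
  intro φ hφ hc
  simp only [Pi.smul_apply, smul_eq_mul, mul_assoc]
  rw [integral_const_mul, integral_const_mul, h φ hφ hc]
  ring

theorem sum {ι : Type*} (s : Finset ι) {F G : ι → EuclideanSpace ℝ (Fin d) → ℝ}
    (hF : ∀ j ∈ s, LocallyIntegrable (F j) volume) (hG : ∀ j ∈ s, LocallyIntegrable (G j) volume)
    (h : ∀ j ∈ s, IsWeakPartialR univ i (F j) (G j)) :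
    IsWeakPartialR univ i (∑ j ∈ s, F j) (∑ j ∈ s, G j) := by
  classical
  induction s using Finset.induction_on with
  | empty => simpa using zero
  | insert a s ha ih =>
    simp only [Finset.forall_mem_insert] at hF hG h
    rw [Finset.sum_insert ha, Finset.sum_insert ha]
    refine add hF.1 hG.1 ?_ ?_ h.1 (ih hF.2 hG.2 h.2)
    · exact Finset.sum_induction _ (LocallyIntegrable · volume) (fun _ _ => .add)
        locallyIntegrable_zero hF.2
    · exact Finset.sum_induction _ (LocallyIntegrable · volume) (fun _ _ => .add)
        locallyIntegrable_zero hG.2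

/-- The weak Leibniz rule with a smooth factor. -/
theorem mul_contDiff (hf : LocallyIntegrable f volume) (hg : LocallyIntegrable g volume)
    (h : IsWeakPartialR univ i f g) {w : EuclideanSpace ℝ (Fin d) → ℝ}
    (hw : ContDiff ℝ (⊤ : ℕ∞) w) :
    IsWeakPartialR univ i (fun x => f x * w x)
      (fun x => g x * w x + f x * fderiv ℝ w x (EuclideanSpace.single i 1)) := by
  rw [isWeakPartialR_univ_iff] at *
  intro φ hφ hc
  have key := h (fun x => w x * φ x) (hw.mul hφ) hc.mul_left
  have e : ∀ x, fderiv ℝ (fun x => w x * φ x) x (EuclideanSpace.single i 1) =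
      w x * fderiv ℝ φ x (EuclideanSpace.single i 1) +
        φ x * fderiv ℝ w x (EuclideanSpace.single i 1) := fun x => by
    rw [fderiv_fun_mul (hw.differentiable (by simp) x) (hφ.differentiable (by simp) x)]
    simp
  have hφ' := continuous_fderiv_apply hφ (EuclideanSpace.single i 1)
  have hw' := continuous_fderiv_apply hw (EuclideanSpace.single i 1)
  have hc' := hc.fderiv_apply (𝕜 := ℝ) (EuclideanSpace.single i 1)
  have i1 := integrable_mul_of_hasCompactSupport hf (hw.continuous.mul hφ') hc'.mul_left
  have i2 := integrable_mul_of_hasCompactSupport hf (hφ.continuous.mul hw') hc.mul_right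
  have i3 := integrable_mul_of_hasCompactSupport hg (hw.continuous.mul hφ.continuous) hc.mul_left
  simp only [Pi.mul_apply] at i1 i2 i3
  simp only [e, mul_add] at key
  rw [integral_add i1 i2] at key
  have e2 : ∀ x, (g x * w x + f x * fderiv ℝ w x (EuclideanSpace.single i 1)) * φ x =
      g x * (w x * φ x) + f x * (φ x * fderiv ℝ w x (EuclideanSpace.single i 1)) :=
    fun x => by ring
  simp only [e2, mul_assoc]
  rw [integral_add i3 i2]
  linarith

end IsWeakPartialR

theorem tendsto_integral_mul_of_tendsto_eLpNorm {p : ℝ≥0∞} (hp : 1 ≤ p)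
    {F : ℕ → EuclideanSpace ℝ (Fin d) → ℝ} {f ψ : EuclideanSpace ℝ (Fin d) → ℝ}
    (hF : ∀ k, MemLp (F k) p volume) (hf : MemLp f p volume)
    (hlim : Tendsto (fun k => eLpNorm (fun x => F k x - f x) p volume) atTop (𝓝 0))
    (hψ : Continuous ψ) (hc : HasCompactSupport ψ) :
    Tendsto (fun k => ∫ x, F k x * ψ x) atTop (𝓝 (∫ x, f x * ψ x)) := by
  have : p.HolderConjugate (ENNReal.conjExponent p) := ENNReal.HolderConjugate.conjExponent hp
  refine tendsto_integral_of_L1' _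
    (integrable_mul_of_hasCompactSupport (hf.locallyIntegrable hp) hψ hc).aestronglyMeasurable
    (Eventually.of_forall fun k =>
      integrable_mul_of_hasCompactSupport ((hF k).locallyIntegrable hp) hψ hc) ?_
  have hψ' := hψ.memLp_of_hasCompactSupport (p := ENNReal.conjExponent p) (μ := volume) hc
  have h0 := ENNReal.Tendsto.mul_const hlim (b := eLpNorm ψ (ENNReal.conjExponent p) volume)
    (Or.inr hψ'.2.ne)
  rw [zero_mul] at h0
  refine tendsto_of_tendsto_of_tendsto_of_le_of_le tendsto_const_nhds h0 (fun _ => zero_le)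
    fun k => ?_
  have := eLpNorm_smul_le_mul_eLpNorm (p := p) (q := ENNReal.conjExponent p) (r := 1)
    hψ'.1 ((hF k).sub hf).1
  refine le_trans (le_of_eq ?_) this
  congr 1
  ext x
  simp [sub_mul]

/-- Weak derivatives are closed under `L^p` limits. -/
theorem isWeakPartialR_of_tendsto {p : ℝ≥0∞} (hp : 1 ≤ p) {i : Fin d}
    {F G : ℕ → EuclideanSpace ℝ (Fin d) → ℝ} {f g : EuclideanSpace ℝ (Fin d) → ℝ}
    (hF : ∀ k, MemLp (F k) p volume) (hf : MemLp f p volume)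
    (hFlim : Tendsto (fun k => eLpNorm (fun x => F k x - f x) p volume) atTop (𝓝 0))
    (hG : ∀ k, MemLp (G k) p volume) (hg : MemLp g p volume)
    (hGlim : Tendsto (fun k => eLpNorm (fun x => G k x - g x) p volume) atTop (𝓝 0))
    (h : ∀ k, IsWeakPartialR univ i (F k) (G k)) : IsWeakPartialR univ i f g := by
  simp only [isWeakPartialR_univ_iff] at *
  intro φ hφ hc
  have h1 := tendsto_integral_mul_of_tendsto_eLpNorm hp hF hf hFlim
    (continuous_fderiv_apply hφ (EuclideanSpace.single i 1))
    (hc.fderiv_apply (𝕜 := ℝ) (EuclideanSpace.single i 1))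
  have h2 := (tendsto_integral_mul_of_tendsto_eLpNorm hp hG hg hGlim hφ.continuous hc).neg
  simp only [h _ φ hφ hc] at h1
  exact tendsto_nhds_unique h1 h2

/-- Mollification commutes with weak differentiation. -/
theorem fderiv_mollify {i : Fin d} {f g : EuclideanSpace ℝ (Fin d) → ℝ}
    (hf : LocallyIntegrable f volume) (h : IsWeakPartialR univ i f g) (k : ℕ)
    (x : EuclideanSpace ℝ (Fin d)) :
    fderiv ℝ (mollify k f) x (EuclideanSpace.single i 1) = mollify k g x := by
  rw [isWeakPartialR_univ_iff] at h
  set ρ := (mollBump d k).normed volume with hρ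
  have hρs : ContDiff ℝ (⊤ : ℕ∞) ρ := (mollBump d k).contDiff_normed
  have hρc : HasCompactSupport ρ := (mollBump d k).hasCompactSupport_normed
  have hd := hρc.hasFDerivAt_convolution_left (ContinuousLinearMap.lsmul ℝ ℝ)
    (hρs.of_le (by simp)) hf x
  have hd' : HasFDerivAt (mollify k f) _ x := hd
  have hcs : HasCompactSupport fun y => ρ (x - y) :=
    hρc.comp_homeomorph (Homeomorph.subLeft x)
  have key := h (fun y => ρ (x - y)) (hρs.comp (by fun_prop)) hcs
  have e : ∀ y, fderiv ℝ (fun y => ρ (x - y)) y (EuclideanSpace.single i 1) =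
      -fderiv ℝ ρ (x - y) (EuclideanSpace.single i 1) := fun y => by
    have h1 := (hρs.differentiable (by simp) (x - y)).hasFDerivAt.comp y
      ((hasFDerivAt_id y).const_sub x)
    have h2 : HasFDerivAt (fun y => ρ (x - y)) _ y := h1
    rw [h2.fderiv]
    simp
  simp only [e, mul_neg, integral_neg, neg_inj] at key
  rw [hd'.fderiv, convolution_eq_swap]
  have hi : Integrable fun t => ((ContinuousLinearMap.lsmul ℝ ℝ).precompL
      (EuclideanSpace ℝ (Fin d))) (fderiv ℝ ρ (x - t)) (f t) := by
    have := (hρc.fderiv (𝕜 := ℝ)).convolutionExists_left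
      ((ContinuousLinearMap.lsmul ℝ ℝ).precompL (EuclideanSpace ℝ (Fin d)))
      (hρs.continuous_fderiv (by simp)) hf x
    exact this.integrable_swap
  rw [ContinuousLinearMap.integral_apply hi]
  rw [mollify, convolution_eq_swap]
  simpa [mul_comm] using key

theorem isWeakPartialR_of_contDiff {i : Fin d} {w : EuclideanSpace ℝ (Fin d) → ℝ}
    (hw : ContDiff ℝ (⊤ : ℕ∞) w) :
    IsWeakPartialR univ i w (fun x => fderiv ℝ w x (EuclideanSpace.single i 1)) := by
  rw [isWeakPartialR_univ_iff]
  intro φ hφ hc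
  have hφ' := continuous_fderiv_apply hφ (EuclideanSpace.single i 1)
  have hw' := continuous_fderiv_apply hw (EuclideanSpace.single i 1)
  have hc' := hc.fderiv_apply (𝕜 := ℝ) (EuclideanSpace.single i 1)
  exact integral_mul_fderiv_eq_neg_fderiv_mul_of_integrable
    (integrable_mul_of_hasCompactSupport hw'.locallyIntegrable hφ.continuous hc)
    (integrable_mul_of_hasCompactSupport hw.continuous.locallyIntegrable hφ' hc')
    (integrable_mul_of_hasCompactSupport hw.continuous.locallyIntegrable hφ.continuous hc)
    (fun x _ => hw.differentiable (by simp) x) (fun x _ => hφ.differentiable (by simp) x)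

theorem IsWeakPartialR.mollify {i : Fin d} {f g : EuclideanSpace ℝ (Fin d) → ℝ}
    (hf : LocallyIntegrable f volume) (h : IsWeakPartialR univ i f g) (k : ℕ) :
    IsWeakPartialR univ i (mollify k f) (mollify k g) := by
  have := isWeakPartialR_of_contDiff (i := i) (contDiff_mollify k hf)
  simpa only [fderiv_mollify hf h k] using this

/-- One step of the Sobolev embedding, gaining integrability at the cost of one derivative. -/
theorem exists_eLpNorm_le_of_isWeakPartialR (d : ℕ) {s σ : ℝ} (hs : 0 < s) (hs1 : s ≤ 1)
    (hσ : 0 ≤ σ) (hσs : σ ≤ s) (hσd : d * σ < 1) :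
    ∃ C : ℝ≥0∞, C ≠ ⊤ ∧ ∀ (f : EuclideanSpace ℝ (Fin d) → ℝ)
      (g : Fin d → EuclideanSpace ℝ (Fin d) → ℝ), LocallyIntegrable f volume → Measurable f →
      (∀ i, Measurable (g i)) → (∀ i, IsWeakPartialR univ i f (g i)) →
      eLpNorm f (ENNReal.ofReal (s - σ))⁻¹ volume ≤
        C * (eLpNorm f (ENNReal.ofReal s)⁻¹ volume +
          ∑ i, eLpNorm (g i) (ENNReal.ofReal s)⁻¹ volume) := by
  obtain ⟨C, hC, h⟩ := exists_eLpNorm_le_of_contDiff d hs hs1 hσ hσs hσd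
  refine ⟨C, hC, fun f g hf hfm hgm hfg => ?_⟩
  refine (Lp.eLpNorm_lim_le_liminf_eLpNorm
    (fun k => (contDiff_mollify k hf).continuous.aestronglyMeasurable) f
    (ae_tendsto_mollify hf)).trans ?_
  refine liminf_le_of_le (by isBoundedDefault) fun b hb => ?_
  obtain ⟨k, hk⟩ := hb.exists
  refine hk.trans ((h _ ((contDiff_mollify k hf).of_le (by simp))).trans ?_)
  simp only [fderiv_mollify hf (hfg _)]
  gcongr
  · exact eLpNorm_mollify_le k hs hs1 hfm
  · exact eLpNorm_mollify_le k hs hs1 (hgm _)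

end WeakDerivatives

section SobolevFamilies

open scoped Topology

variable {d : ℕ}

/-- A family of measurable representatives of weak derivatives on the whole space up to order `n`,
all of them in `L^{1/s}`. -/
structure IsSobolevFamily (n : ℕ) (s : ℝ) (D : (Fin d → ℕ) → EuclideanSpace ℝ (Fin d) → ℝ) :
    Prop where
  measurable : ∀ α : Fin d → ℕ, ∑ i, α i ≤ n → Measurable (D α)
  memLp : ∀ α : Fin d → ℕ, ∑ i, α i ≤ n → MemLp (D α) (ENNReal.ofReal s)⁻¹ volume
  isWeakPartialR : ∀ α : Fin d → ℕ, ∑ i, α i < n → ∀ i,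
    IsWeakPartialR univ i (D α) (D (α + Pi.single i 1))

/-- The norm of a family of functions on the whole space, with exponent `1/s`. -/
def famNorm (n : ℕ) (s : ℝ) (D : (Fin d → ℕ) → EuclideanSpace ℝ (Fin d) → ℝ) : ℝ≥0∞ :=
  ∑ α ∈ multiIdx d n, eLpNorm (D α) (ENNReal.ofReal s)⁻¹ volume

theorem mem_multiIdx {n : ℕ} {α : Fin d → ℕ} : α ∈ multiIdx d n ↔ ∑ i, α i ≤ n := by
  simp only [multiIdx, Finset.mem_filter, Fintype.mem_piFinset, Finset.mem_range,
    and_iff_right_iff_imp]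
  intro h i
  have := Finset.single_le_sum (f := α) (fun _ _ => Nat.zero_le _) (Finset.mem_univ i)
  omega

theorem sum_add_single (α : Fin d → ℕ) (i : Fin d) :
    ∑ j, (α + Pi.single i 1 : Fin d → ℕ) j = ∑ j, α j + 1 := by
  simp [Finset.sum_add_distrib, Finset.sum_pi_single']

theorem eLpNorm_le_famNorm {n : ℕ} {s : ℝ} (D : (Fin d → ℕ) → EuclideanSpace ℝ (Fin d) → ℝ)
    {α : Fin d → ℕ} (hα : ∑ i, α i ≤ n) :
    eLpNorm (D α) (ENNReal.ofReal s)⁻¹ volume ≤ famNorm n s D :=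
  Finset.single_le_sum (f := fun α => eLpNorm (D α) (ENNReal.ofReal s)⁻¹ volume)
    (fun _ _ => zero_le) (mem_multiIdx.2 hα)

theorem one_le_inv_ofReal {s : ℝ} (hs1 : s ≤ 1) : 1 ≤ (ENNReal.ofReal s)⁻¹ := by
  rw [ENNReal.one_le_inv]
  exact ENNReal.ofReal_le_one.2 hs1

namespace IsSobolevFamily

variable {n : ℕ} {s : ℝ} {D D' : (Fin d → ℕ) → EuclideanSpace ℝ (Fin d) → ℝ}

theorem locallyIntegrable (hD : IsSobolevFamily n s D) (hs1 : s ≤ 1) {α : Fin d → ℕ}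
    (hα : ∑ i, α i ≤ n) : LocallyIntegrable (D α) volume :=
  (hD.memLp α hα).locallyIntegrable (one_le_inv_ofReal hs1)

theorem famNorm_ne_top (hD : IsSobolevFamily n s D) : famNorm n s D ≠ ⊤ :=
  ENNReal.sum_ne_top.2 fun α hα => (hD.memLp α (mem_multiIdx.1 hα)).2.ne

theorem memLp_mollify (hD : IsSobolevFamily n s D) (hs : 0 < s) (hs1 : s ≤ 1) (k : ℕ)
    {α : Fin d → ℕ} (hα : ∑ i, α i ≤ n) :
    MemLp (mollify k (D α)) (ENNReal.ofReal s)⁻¹ volume :=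
  ⟨(contDiff_mollify k (hD.locallyIntegrable hs1 hα)).continuous.aestronglyMeasurable,
    (eLpNorm_mollify_le k hs hs1 (hD.measurable α hα)).trans_lt (hD.memLp α hα).2⟩

theorem mollify (hD : IsSobolevFamily n s D) (hs : 0 < s) (hs1 : s ≤ 1) (k : ℕ) :
    IsSobolevFamily n s (fun α => mollify k (D α)) where
  measurable _ hα := (contDiff_mollify k (hD.locallyIntegrable hs1 hα)).continuous.measurable
  memLp _ hα := hD.memLp_mollify hs hs1 k hα
  isWeakPartialR α hα i :=
    (hD.isWeakPartialR α hα i).mollify (hD.locallyIntegrable hs1 hα.le) k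

theorem sub (hD : IsSobolevFamily n s D) (hD' : IsSobolevFamily n s D') (hs1 : s ≤ 1) :
    IsSobolevFamily n s (fun α x => D α x - D' α x) where
  measurable α hα := (hD.measurable α hα).sub (hD'.measurable α hα)
  memLp α hα := (hD.memLp α hα).sub (hD'.memLp α hα)
  isWeakPartialR α hα i := by
    have hα' : ∑ j, (α + Pi.single i 1 : Fin d → ℕ) j ≤ n := by rw [sum_add_single]; omega
    have := (hD.isWeakPartialR α hα i).add (hD.locallyIntegrable hs1 hα.le)
      (hD.locallyIntegrable hs1 hα') ((hD'.locallyIntegrable hs1 hα.le).smul (-1 : ℝ))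
      ((hD'.locallyIntegrable hs1 hα').smul (-1 : ℝ))
      ((hD'.isWeakPartialR α hα i).const_smul (-1))
    convert this using 1 <;> ext x <;> simp [sub_eq_add_neg]

theorem tendsto_famNorm_mollify_sub (hD : IsSobolevFamily n s D) (hs : 0 < s) (hs1 : s ≤ 1) :
    Tendsto (fun k => famNorm n s (fun α x => _root_.mollify k (D α) x - D α x)) atTop (𝓝 0) := by
  rw [← Finset.sum_const_zero (s := multiIdx d n) (ι := Fin d → ℕ)]
  exact tendsto_finsetSum _ fun α hα => tendsto_eLpNorm_mollify_sub hs hs1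
    (hD.measurable α (mem_multiIdx.1 hα)) (hD.memLp α (mem_multiIdx.1 hα))

end IsSobolevFamily

/-- The Sobolev embedding for families of weak derivatives. -/
theorem exists_eLpNorm_le_famNorm (d n : ℕ) {s σ : ℝ} (hs1 : s ≤ 1) (hσ : 0 < σ)
    (hσd : d * σ < 1) (j : ℕ) (hj : j * σ ≤ s) :
    ∃ C : ℝ≥0∞, C ≠ ⊤ ∧ ∀ D : (Fin d → ℕ) → EuclideanSpace ℝ (Fin d) → ℝ,
      IsSobolevFamily n s D → ∀ α : Fin d → ℕ, ∑ i, α i + j ≤ n →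
      eLpNorm (D α) (ENNReal.ofReal (s - j * σ))⁻¹ volume ≤ C * famNorm n s D := by
  induction j with
  | zero =>
    exact ⟨1, by simp, fun D _ α hα => by simpa using eLpNorm_le_famNorm D hα⟩
  | succ j ih =>
    push_cast at hj ⊢
    have hjσ : 0 ≤ j * σ := by positivity
    obtain ⟨C, hC, h⟩ := ih (by linarith)
    obtain ⟨C', hC', h'⟩ := exists_eLpNorm_le_of_isWeakPartialR d (s := s - j * σ) (σ := σ)
      (by linarith) (by linarith) hσ.le (by linarith) hσd
    refine ⟨C' * (C + d * C), by finiteness, fun D hD α hα => ?_⟩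
    have hα' (i : Fin d) : ∑ k, (α + Pi.single i 1 : Fin d → ℕ) k + j ≤ n := by
      rw [sum_add_single]; omega
    have key := h' (D α) (fun i => D (α + Pi.single i 1)) (hD.locallyIntegrable hs1 (by omega))
      (hD.measurable α (by omega)) (fun i => hD.measurable _ (by have := hα' i; omega))
      (hD.isWeakPartialR α (by omega))
    rw [show s - (j + 1) * σ = s - j * σ - σ by ring]
    refine key.trans ?_
    rw [mul_assoc, add_mul]
    gcongr
    · exact h D hD α (by omega)
    · refine (Finset.sum_le_sum fun i _ => h D hD _ (hα' i)).trans ?_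
      simp [mul_assoc]

theorem exists_eLpNorm_mul_le_of_le_add (d n : ℕ) (hn : 1 ≤ n) {s : ℝ} (hs : 0 < s) (hs1 : s ≤ 1)
    (hsd : d * s < n) (b c : ℕ) (hbc : n ≤ b + c) :
    ∃ C : ℝ≥0∞, C ≠ ⊤ ∧ ∀ D D' : (Fin d → ℕ) → EuclideanSpace ℝ (Fin d) → ℝ,
      IsSobolevFamily n s D → IsSobolevFamily n s D' → ∀ β γ : Fin d → ℕ,
      ∑ i, β i + b ≤ n → ∑ i, γ i + c ≤ n →
      eLpNorm (fun x => D β x * D' γ x) (ENNReal.ofReal s)⁻¹ volume ≤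
        C * famNorm n s D * famNorm n s D' := by
  have hm : (0 : ℝ) < b + c := by exact_mod_cast (by omega : 0 < b + c)
  have hnm : (n : ℝ) ≤ b + c := by exact_mod_cast hbc
  set σ := s / (b + c) with hσ
  have hσ0 : 0 < σ := by positivity
  have hσd : d * σ < 1 := by
    rw [hσ, ← mul_div_assoc, div_lt_one hm]; linarith
  have hsum : b * σ + c * σ = s := by rw [hσ]; field_simp
  have hb0 : 0 ≤ b * σ := by positivity
  have hc0 : 0 ≤ c * σ := by positivity
  obtain ⟨C, hC, h⟩ := exists_eLpNorm_le_famNorm d n hs1 hσ0 hσd b (by linarith)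
  obtain ⟨C', hC', h'⟩ := exists_eLpNorm_le_famNorm d n hs1 hσ0 hσd c (by linarith)
  refine ⟨C * C', by finiteness, fun D D' hD hD' β γ hβ hγ => ?_⟩
  have : ENNReal.HolderTriple (ENNReal.ofReal (s - b * σ))⁻¹ (ENNReal.ofReal (s - c * σ))⁻¹
      (ENNReal.ofReal s)⁻¹ := ⟨by
    rw [inv_inv, inv_inv, inv_inv, ← ENNReal.ofReal_add (by linarith) (by linarith)]
    congr 1
    linarith⟩
  refine (eLpNorm_smul_le_mul_eLpNorm (p := (ENNReal.ofReal (s - b * σ))⁻¹)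
    (q := (ENNReal.ofReal (s - c * σ))⁻¹) (hD'.memLp γ (by omega)).1
    (hD.memLp β (by omega)).1).trans ?_
  refine (mul_le_mul' (h D hD β hβ) (h' D' hD' γ hγ)).trans (le_of_eq ?_)
  ring

/-- The bilinear estimate behind the algebra property: products of derivatives of total order at
most `n` are controlled when `n` exceeds `d` times `s`. -/
theorem exists_eLpNorm_mul_le (d n : ℕ) (hn : 1 ≤ n) {s : ℝ} (hs : 0 < s) (hs1 : s ≤ 1)
    (hsd : d * s < n) :
    ∃ C : ℝ≥0∞, C ≠ ⊤ ∧ ∀ D D' : (Fin d → ℕ) → EuclideanSpace ℝ (Fin d) → ℝ,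
      IsSobolevFamily n s D → IsSobolevFamily n s D' → ∀ β γ : Fin d → ℕ,
      ∑ i, β i + ∑ i, γ i ≤ n →
      eLpNorm (fun x => D β x * D' γ x) (ENNReal.ofReal s)⁻¹ volume ≤
        C * famNorm n s D * famNorm n s D' := by
  choose C hC h using exists_eLpNorm_mul_le_of_le_add d n hn hs hs1 hsd
  let K : ℕ × ℕ → ℝ≥0∞ := fun q => if hq : n ≤ q.1 + q.2 then C q.1 q.2 hq else 0
  refine ⟨∑ q ∈ Finset.range (n + 1) ×ˢ Finset.range (n + 1), K q,
    ENNReal.sum_ne_top.2 fun q _ => ?_, fun D D' hD hD' β γ hβγ => ?_⟩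
  · simp only [K]
    split_ifs
    exacts [hC _ _ _, ENNReal.zero_ne_top]
  · have hle : n ≤ n - ∑ i, β i + (n - ∑ i, γ i) := by omega
    refine (h (n - ∑ i, β i) (n - ∑ i, γ i) hle D D' hD hD' β γ (by omega)
      (by omega)).trans ?_
    gcongr
    refine le_trans (le_of_eq ?_) (Finset.single_le_sum (f := K) (fun _ _ => zero_le)
      (a := (n - ∑ i, β i, n - ∑ i, γ i)) (by simp))
    simp only [K]
    rw [dif_pos hle]

namespace IsSobolevFamily

variable {n : ℕ} {s : ℝ} {D D' : (Fin d → ℕ) → EuclideanSpace ℝ (Fin d) → ℝ}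

theorem memLp_mul (hn : 1 ≤ n) (hs : 0 < s) (hs1 : s ≤ 1) (hsd : d * s < n)
    (hD : IsSobolevFamily n s D) (hD' : IsSobolevFamily n s D') {β γ : Fin d → ℕ}
    (h : ∑ i, β i + ∑ i, γ i ≤ n) :
    MemLp (fun x => D β x * D' γ x) (ENNReal.ofReal s)⁻¹ volume := by
  obtain ⟨C, hC, hCle⟩ := exists_eLpNorm_mul_le d n hn hs hs1 hsd
  refine ⟨(hD.memLp β (by omega)).1.mul (hD'.memLp γ (by omega)).1,
    (hCle D D' hD hD' β γ h).trans_lt ?_⟩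
  have := hD.famNorm_ne_top
  have := hD'.famNorm_ne_top
  exact lt_top_iff_ne_top.2 (by finiteness)

/-- The weak Leibniz rule for derivatives of low total order. -/
theorem isWeakPartialR_mul (hn : 1 ≤ n) (hs : 0 < s) (hs1 : s ≤ 1) (hsd : d * s < n)
    (hD : IsSobolevFamily n s D) (hD' : IsSobolevFamily n s D') {β γ : Fin d → ℕ}
    (h : ∑ i, β i + ∑ i, γ i < n) (i : Fin d) :
    IsWeakPartialR univ i (fun x => D β x * D' γ x)
      ((fun x => D (β + Pi.single i 1) x * D' γ x) +
        fun x => D β x * D' (γ + Pi.single i 1) x) := by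
  obtain ⟨C, hC, hCle⟩ := exists_eLpNorm_mul_le d n hn hs hs1 hsd
  have hβ := sum_add_single β i
  have hγ := sum_add_single γ i
  have hM := hD'.mollify hs hs1
  have hlim : ∀ β' γ' : Fin d → ℕ, ∑ i, β' i + ∑ i, γ' i ≤ n →
      Tendsto (fun k => eLpNorm (fun x => D β' x * (_root_.mollify k (D' γ') x - D' γ' x))
        (ENNReal.ofReal s)⁻¹ volume) atTop (𝓝 0) := fun β' γ' hle => by
    have h0 := ENNReal.Tendsto.const_mul (hD'.tendsto_famNorm_mollify_sub hs hs1)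
      (a := C * famNorm n s D) (Or.inr (ENNReal.mul_ne_top hC hD.famNorm_ne_top))
    rw [mul_zero] at h0
    exact tendsto_of_tendsto_of_tendsto_of_le_of_le tendsto_const_nhds h0 (fun _ => zero_le)
      fun k => hCle D _ hD ((hM k).sub hD' hs1) β' γ' hle
  refine isWeakPartialR_of_tendsto (one_le_inv_ofReal hs1)
    (F := fun k x => D β x * _root_.mollify k (D' γ) x)
    (G := fun k => (fun x => D (β + Pi.single i 1) x * _root_.mollify k (D' γ) x) +
      fun x => D β x * _root_.mollify k (D' (γ + Pi.single i 1)) x)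
    (fun k => memLp_mul hn hs hs1 hsd hD (hM k) h.le) (memLp_mul hn hs hs1 hsd hD hD' h.le) ?_
    (fun k => (memLp_mul hn hs hs1 hsd hD (hM k) (by omega)).add
      (memLp_mul hn hs hs1 hsd hD (hM k) (by omega)))
    ((memLp_mul hn hs hs1 hsd hD hD' (by omega)).add
      (memLp_mul hn hs hs1 hsd hD hD' (by omega))) ?_ fun k => ?_
  · simpa only [mul_sub] using hlim β γ h.le
  · have h2 := (hlim (β + Pi.single i 1) γ (by omega)).add (hlim β (γ + Pi.single i 1) (by omega))
    rw [add_zero] at h2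
    refine tendsto_of_tendsto_of_tendsto_of_le_of_le tendsto_const_nhds h2 (fun _ => zero_le)
      fun k => ?_
    refine le_trans (le_of_eq ?_) (eLpNorm_add_le ?_ ?_ (one_le_inv_ofReal hs1))
    · congr 1
      ext x
      simp only [Pi.add_apply]
      ring
    · exact (hD.memLp _ (by omega)).1.mul (((hM k).sub hD' hs1).memLp γ (by omega)).1
    · exact (hD.memLp β (by omega)).1.mul (((hM k).sub hD' hs1).memLp _ (by omega)).1
  · have hloc := hD'.locallyIntegrable hs1 (α := γ) (by omega)
    have := (hD.isWeakPartialR β (by omega) i).mul_contDiff (hD.locallyIntegrable hs1 (by omega))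
      (hD.locallyIntegrable hs1 (by omega)) (contDiff_mollify k hloc)
    simp only [fderiv_mollify hloc (hD'.isWeakPartialR γ (by omega) i)] at this
    exact this

end IsSobolevFamily

end SobolevFamilies

section Products

variable {d : ℕ}

/-- The polynomial `∏ i, (X i + Y i) ^ α i` whose coefficients are those of the Leibniz rule. -/
def leibnizPoly (α : Fin d → ℕ) : MvPolynomial (Fin d ⊕ Fin d) ℝ :=
  ∏ i, (MvPolynomial.X (Sum.inl i) + MvPolynomial.X (Sum.inr i)) ^ α i

theorem leibnizPoly_add_single (α : Fin d → ℕ) (i : Fin d) :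
    leibnizPoly (α + Pi.single i 1) =
      leibnizPoly α * (MvPolynomial.X (Sum.inl i) + MvPolynomial.X (Sum.inr i)) := by
  simp only [leibnizPoly, Pi.add_apply, pow_add, Finset.prod_mul_distrib]
  congr 1
  rw [Finset.prod_eq_single i (fun j _ hj => by simp [hj]) (by simp)]
  simp

theorem isHomogeneous_leibnizPoly (α : Fin d → ℕ) :
    (leibnizPoly α).IsHomogeneous (∑ i, α i) :=
  MvPolynomial.IsHomogeneous.prod _ _ _ fun i _ => by
    simpa using ((MvPolynomial.isHomogeneous_X ℝ (Sum.inl i)).add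
      (MvPolynomial.isHomogeneous_X ℝ (Sum.inr i))).pow (α i)

theorem sum_eq_of_mem_support_leibnizPoly {α : Fin d → ℕ} {m : Fin d ⊕ Fin d →₀ ℕ}
    (hm : m ∈ (leibnizPoly α).support) :
    ∑ i, m (Sum.inl i) + ∑ i, m (Sum.inr i) = ∑ i, α i := by
  have := isHomogeneous_leibnizPoly α (MvPolynomial.mem_support_iff.1 hm)
  rw [← Fintype.sum_sum_type, ← Finsupp.degree_eq_sum, Finsupp.degree_eq_weight_one, ← this]
  rfl

/-- The product of the two derivatives encoded by a monomial in two sets of variables. -/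
def monomialMul (D D' : (Fin d → ℕ) → EuclideanSpace ℝ (Fin d) → ℝ) (m : Fin d ⊕ Fin d →₀ ℕ) :
    EuclideanSpace ℝ (Fin d) → ℝ :=
  fun x => D (fun i => m (Sum.inl i)) x * D' (fun i => m (Sum.inr i)) x

/-- The linear extension of `monomialMul` to polynomials. -/
def polyMul (D D' : (Fin d → ℕ) → EuclideanSpace ℝ (Fin d) → ℝ) :
    MvPolynomial (Fin d ⊕ Fin d) ℝ →ₗ[ℝ] EuclideanSpace ℝ (Fin d) → ℝ :=
  (MvPolynomial.basisMonomials (Fin d ⊕ Fin d) ℝ).constr ℝ (monomialMul D D')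

theorem polyMul_monomial (D D' : (Fin d → ℕ) → EuclideanSpace ℝ (Fin d) → ℝ)
    (m : Fin d ⊕ Fin d →₀ ℕ) (c : ℝ) :
    polyMul D D' (MvPolynomial.monomial m c) = c • monomialMul D D' m := by
  have h : MvPolynomial.monomial m c = c • MvPolynomial.basisMonomials (Fin d ⊕ Fin d) ℝ m := by
    simp [MvPolynomial.smul_monomial]
  rw [h, map_smul, polyMul, Module.Basis.constr_basis]

theorem polyMul_eq_sum (D D' : (Fin d → ℕ) → EuclideanSpace ℝ (Fin d) → ℝ)
    (P : MvPolynomial (Fin d ⊕ Fin d) ℝ) :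
    polyMul D D' P = ∑ m ∈ P.support, P.coeff m • monomialMul D D' m := by
  conv_lhs => rw [← P.support_sum_monomial_coeff]
  simp only [map_sum, polyMul_monomial]

theorem polyMul_mul_X_add_X (D D' : (Fin d → ℕ) → EuclideanSpace ℝ (Fin d) → ℝ)
    (P : MvPolynomial (Fin d ⊕ Fin d) ℝ) (i : Fin d) :
    polyMul D D' (P * (MvPolynomial.X (Sum.inl i) + MvPolynomial.X (Sum.inr i))) =
      ∑ m ∈ P.support, P.coeff m • (monomialMul D D' (m + Finsupp.single (Sum.inl i) 1) +
        monomialMul D D' (m + Finsupp.single (Sum.inr i) 1)) := by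
  conv_lhs => rw [← P.support_sum_monomial_coeff]
  simp only [Finset.sum_mul, map_sum, mul_add, MvPolynomial.X, MvPolynomial.monomial_mul, mul_one,
    map_add, polyMul_monomial, smul_add, Finset.sum_add_distrib]

theorem monomialMul_add_single_inl (D D' : (Fin d → ℕ) → EuclideanSpace ℝ (Fin d) → ℝ)
    (m : Fin d ⊕ Fin d →₀ ℕ) (i : Fin d) :
    monomialMul D D' (m + Finsupp.single (Sum.inl i) 1) = fun x =>
      D ((fun j => m (Sum.inl j)) + Pi.single i 1) x * D' (fun j => m (Sum.inr j)) x := by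
  have h : (fun j => (m + Finsupp.single (Sum.inl i) 1 : Fin d ⊕ Fin d →₀ ℕ) (Sum.inl j)) =
      (fun j => m (Sum.inl j)) + Pi.single i 1 := by
    ext j
    simp [Finsupp.single_apply, Pi.single_apply, eq_comm]
  ext x
  rw [monomialMul, h]
  simp

theorem monomialMul_add_single_inr (D D' : (Fin d → ℕ) → EuclideanSpace ℝ (Fin d) → ℝ)
    (m : Fin d ⊕ Fin d →₀ ℕ) (i : Fin d) :
    monomialMul D D' (m + Finsupp.single (Sum.inr i) 1) = fun x =>
      D (fun j => m (Sum.inl j)) x * D' ((fun j => m (Sum.inr j)) + Pi.single i 1) x := by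
  have h : (fun j => (m + Finsupp.single (Sum.inr i) 1 : Fin d ⊕ Fin d →₀ ℕ) (Sum.inr j)) =
      (fun j => m (Sum.inr j)) + Pi.single i 1 := by
    ext j
    simp [Finsupp.single_apply, Pi.single_apply, eq_comm]
  ext x
  rw [monomialMul, h]
  simp

variable {n : ℕ} {s : ℝ} {D D' : (Fin d → ℕ) → EuclideanSpace ℝ (Fin d) → ℝ}

theorem IsSobolevFamily.polyMul (hn : 1 ≤ n) (hs : 0 < s) (hs1 : s ≤ 1) (hsd : d * s < n)
    (hD : IsSobolevFamily n s D) (hD' : IsSobolevFamily n s D') :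
    IsSobolevFamily n s (fun α => polyMul D D' (leibnizPoly α)) where
  measurable α hα := by
    rw [polyMul_eq_sum]
    refine Finset.sum_induction _ Measurable (fun _ _ => .add) measurable_const fun m hm => ?_
    have := sum_eq_of_mem_support_leibnizPoly hm
    exact ((hD.measurable _ (by omega)).mul (hD'.measurable _ (by omega))).const_smul _
  memLp α hα := by
    rw [polyMul_eq_sum]
    refine memLp_finsetSum' _ fun m hm => ?_
    have := sum_eq_of_mem_support_leibnizPoly hm
    exact (hD.memLp_mul hn hs hs1 hsd hD' (by omega)).const_smul _
  isWeakPartialR α hα i := by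
    have hL : ∀ {β γ : Fin d → ℕ}, ∑ j, β j + ∑ j, γ j ≤ n →
        LocallyIntegrable (fun x => D β x * D' γ x) volume := fun h =>
      (hD.memLp_mul hn hs hs1 hsd hD' h).locallyIntegrable (one_le_inv_ofReal hs1)
    simp only [leibnizPoly_add_single, polyMul_mul_X_add_X]
    rw [polyMul_eq_sum]
    refine IsWeakPartialR.sum _ (fun m hm => ?_) (fun m hm => ?_) fun m hm => ?_ <;>
      have hm' := sum_eq_of_mem_support_leibnizPoly hm
    · exact (hL (by omega)).smul _
    · rw [monomialMul_add_single_inl, monomialMul_add_single_inr]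
      have h1 := sum_add_single (fun j => m (Sum.inl j)) i
      have h2 := sum_add_single (fun j => m (Sum.inr j)) i
      exact ((hL (by omega)).add (hL (by omega))).smul _
    · rw [monomialMul_add_single_inl, monomialMul_add_single_inr]
      exact (hD.isWeakPartialR_mul hn hs hs1 hsd hD' (by omega) i).const_smul _

theorem polyMul_leibnizPoly_zero (D D' : (Fin d → ℕ) → EuclideanSpace ℝ (Fin d) → ℝ) :
    polyMul D D' (leibnizPoly 0) = fun x => D 0 x * D' 0 x := by
  have h : leibnizPoly (0 : Fin d → ℕ) = MvPolynomial.monomial 0 1 := by simp [leibnizPoly]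
  rw [h, polyMul_monomial, one_smul]
  rfl

theorem exists_famNorm_polyMul_le (d n : ℕ) (hn : 1 ≤ n) {s : ℝ} (hs : 0 < s) (hs1 : s ≤ 1)
    (hsd : d * s < n) :
    ∃ C : ℝ≥0∞, C ≠ ⊤ ∧ ∀ D D' : (Fin d → ℕ) → EuclideanSpace ℝ (Fin d) → ℝ,
      IsSobolevFamily n s D → IsSobolevFamily n s D' →
      famNorm n s (fun α => polyMul D D' (leibnizPoly α)) ≤
        C * (famNorm n s D * famNorm n s D') := by
  obtain ⟨C, hC, h⟩ := exists_eLpNorm_mul_le d n hn hs hs1 hsd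
  refine ⟨∑ α ∈ multiIdx d n, ∑ m ∈ (leibnizPoly α).support, ‖(leibnizPoly α).coeff m‖ₑ * C,
    ENNReal.sum_ne_top.2 fun α _ => ENNReal.sum_ne_top.2 fun m _ => by finiteness,
    fun D D' hD hD' => ?_⟩
  rw [famNorm, Finset.sum_mul]
  refine Finset.sum_le_sum fun α hα => ?_
  rw [mem_multiIdx] at hα
  rw [polyMul_eq_sum, Finset.sum_mul]
  refine (eLpNorm_sum_le (fun m hm => ?_) (one_le_inv_ofReal hs1)).trans
    (Finset.sum_le_sum fun m hm => ?_) <;>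
    have hm' := sum_eq_of_mem_support_leibnizPoly hm
  · exact (hD.memLp_mul hn hs hs1 hsd hD' (by omega)).1.const_smul _
  · rw [eLpNorm_const_smul, mul_assoc]
    gcongr
    rw [← mul_assoc]
    exact h D D' hD hD' _ _ (by omega)

end Products

section Domains

variable {d : ℕ} {Ω : Set (EuclideanSpace ℝ (Fin d))} {i : Fin d}
  {f g f' g' : EuclideanSpace ℝ (Fin d) → ℝ}

theorem IsWeakPartialR.congr_ae (h : IsWeakPartialR Ω i f g) (hf : f =ᵐ[volume.restrict Ω] f')
    (hg : g =ᵐ[volume.restrict Ω] g') : IsWeakPartialR Ω i f' g' := fun φ hφ => by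
  refine (integral_congr_ae (hf.symm.mul .rfl)).trans ((h φ hφ).trans ?_)
  exact congrArg Neg.neg (integral_congr_ae (hg.mul .rfl))

theorem IsWeakPartialR.of_univ (h : IsWeakPartialR univ i f g) : IsWeakPartialR Ω i f g := by
  intro φ ⟨hφ, hc, hsupp⟩
  rw [setIntegral_eq_integral_of_forall_compl_eq_zero fun x hx => ?_,
    setIntegral_eq_integral_of_forall_compl_eq_zero fun x hx => ?_]
  · exact isWeakPartialR_univ_iff.1 h φ hφ hc
  · rw [image_eq_zero_of_notMem_tsupport fun hx' => hx (hsupp hx'), mul_zero]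
  · have : fderiv ℝ φ x = 0 :=
      Function.notMem_support.1 fun hx' => hx (hsupp (support_fderiv_subset ℝ hx'))
    simp [this]

theorem sobNormR_le_famNorm {n : ℕ} {p : ℝ} (hp : 0 < p)
    {D : (Fin d → ℕ) → EuclideanSpace ℝ (Fin d) → ℝ} (hD : IsSobolevFamily n p⁻¹ D)
    (h0 : D 0 =ᵐ[volume.restrict Ω] f) : sobNormR n p Ω f ≤ famNorm n p⁻¹ D := by
  have hae : ∀ α, D α =ᵐ[volume.restrict Ω] Function.update D 0 f α := fun α => by
    rcases eq_or_ne α 0 with rfl | hα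
    · simpa using h0
    · simp [hα]
  have hfam : IsWeakDerivFamilyR Ω n f (Function.update D 0 f) :=
    ⟨by simp, fun α hα => ((hD.measurable α hα).aestronglyMeasurable).congr (hae α),
      fun α hα i => (hD.isWeakPartialR α hα i).of_univ.congr_ae (hae _) (hae _)⟩
  refine (iInf₂_le _ hfam).trans (Finset.sum_le_sum fun α _ => ?_)
  rw [← eLpNorm_congr_ae (hae α), ENNReal.ofReal_inv_of_pos hp, inv_inv]
  exact eLpNorm_mono_measure _ Measure.restrict_le_self

theorem IsWeakDerivFamilyR.exists_isSobolevFamily {n : ℕ} {p : ℝ} (hp : 0 < p)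
    {D : (Fin d → ℕ) → EuclideanSpace ℝ (Fin d) → ℝ} (hD : IsWeakDerivFamilyR univ n f D)
    (hfin : famNormR n p univ D < ⊤) :
    ∃ D', IsSobolevFamily n p⁻¹ D' ∧ D' 0 =ᵐ[volume] f ∧
      famNorm n p⁻¹ D' = famNormR n p univ D := by
  classical
  obtain ⟨h0, hm, hw⟩ := hD
  have hq : (ENNReal.ofReal p⁻¹)⁻¹ = ENNReal.ofReal p := by
    rw [ENNReal.ofReal_inv_of_pos hp, inv_inv]
  let D' : (Fin d → ℕ) → EuclideanSpace ℝ (Fin d) → ℝ :=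
    fun α => if hα : ∑ i, α i ≤ n then (hm α hα).mk else 0
  have hD'm : ∀ α, ∑ i, α i ≤ n → StronglyMeasurable (D' α) := fun α hα => by
    simp only [D', dif_pos hα]
    exact (hm α hα).stronglyMeasurable_mk
  have hae : ∀ α, ∑ i, α i ≤ n → D α =ᵐ[volume.restrict univ] D' α := fun α hα => by
    simp only [D', dif_pos hα]
    exact (hm α hα).ae_eq_mk
  have hnorm : ∀ α, ∑ i, α i ≤ n → eLpNorm (D' α) (ENNReal.ofReal p⁻¹)⁻¹ volume =
      eLpNorm (D α) (ENNReal.ofReal p) (volume.restrict univ) := fun α hα => by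
    rw [hq, eLpNorm_congr_ae (hae α hα), Measure.restrict_univ]
  refine ⟨D', ⟨fun α hα => (hD'm α hα).measurable,
    fun α hα => ⟨(hD'm α hα).aestronglyMeasurable, ?_⟩, fun α hα i => ?_⟩, ?_, ?_⟩
  · rw [hnorm α hα]
    exact ENNReal.sum_lt_top.1 hfin α (mem_multiIdx.2 hα)
  · exact (hw α hα i).congr_ae (hae α hα.le) (hae _ (by rw [sum_add_single]; omega))
  · have := hae 0 (by simp)
    rw [Measure.restrict_univ, h0] at this
    exact this.symm
  · exact Finset.sum_congr rfl fun α hα => hnorm α (mem_multiIdx.1 hα)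

/-- The product estimate on a domain for restrictions of functions on the whole space. -/
theorem exists_sobNormR_mul_le_univ (d n : ℕ) (hn : 1 ≤ n) {p : ℝ} (hp : 1 < p)
    (hnp : (d : ℝ) < n * p) :
    ∃ C : ℝ≥0∞, C ≠ ⊤ ∧ ∀ (Ω : Set (EuclideanSpace ℝ (Fin d)))
      (f g F G : EuclideanSpace ℝ (Fin d) → ℝ),
      F =ᵐ[volume.restrict Ω] f → G =ᵐ[volume.restrict Ω] g →
      MemSobolevR n p univ F → MemSobolevR n p univ G →
      sobNormR n p Ω (fun x => f x * g x) ≤ C * (sobNormR n p univ F * sobNormR n p univ G) := by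
  have hp0 : 0 < p := by linarith
  have hs1 : p⁻¹ ≤ 1 := inv_le_one_of_one_le₀ hp.le
  have hsd : d * p⁻¹ < n := by rwa [← div_eq_mul_inv, div_lt_iff₀ hp0]
  obtain ⟨C, hC, h⟩ := exists_famNorm_polyMul_le d n hn (inv_pos.2 hp0) hs1 hsd
  refine ⟨C + 1, by finiteness, fun Ω f g F G hFf hGg hF hG => ?_⟩
  rw [mul_comm, ← ENNReal.div_le_iff (by simp) (by finiteness)]
  refine ENNReal.le_mul_of_forall_lt (.inr hG.ne) (.inl hF.ne) fun a ha b hb => ?_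
  rw [ENNReal.div_le_iff (by simp) (by finiteness)]
  obtain ⟨DF, hDF, hDFa⟩ := by simpa only [sobNormR, iInf_lt_iff] using ha
  obtain ⟨DG, hDG, hDGb⟩ := by simpa only [sobNormR, iInf_lt_iff] using hb
  obtain ⟨D, hD, hD0, hDn⟩ := hDF.exists_isSobolevFamily hp0 (hDFa.trans_le le_top)
  obtain ⟨D', hD', hD'0, hD'n⟩ := hDG.exists_isSobolevFamily hp0 (hDGb.trans_le le_top)
  have key := sobNormR_le_famNorm (Ω := Ω) (f := fun x => f x * g x) hp0
    (hD.polyMul hn (inv_pos.2 hp0) hs1 hsd hD') (by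
      rw [polyMul_leibnizPoly_zero]
      exact (hD0.restrict.trans hFf).mul (hD'0.restrict.trans hGg))
  refine key.trans ((h D D' hD hD').trans ?_)
  rw [hDn, hD'n, mul_comm]
  gcongr
  exact le_self_add

end Domains

end

noncomputable section

/-- If `np > d` and `Ω ⊆ ℝ^d` is a Sobolev extension domain, then
`W^{n,p}(Ω)` is a multiplicative algebra. -/
theorem sobolev_is_algebra
    (d n : ℕ) (hd : 0 < d) (hn : 1 ≤ n) (p : ℝ) (hp : 1 < p) (hnp : (d : ℝ) < n * p)
    (Ω : Set (EuclideanSpace ℝ (Fin d))) (hΩ : IsOpen Ω)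
    (hext : IsExtensionDomain n p Ω) :
    ∃ C : ℝ≥0∞, C ≠ ⊤ ∧
      ∀ f g : EuclideanSpace ℝ (Fin d) → ℝ,
        MemSobolevR n p Ω f → MemSobolevR n p Ω g →
          MemSobolevR n p Ω (fun x => f x * g x) ∧
          sobNormR n p Ω (fun x => f x * g x) ≤
            C * sobNormR n p Ω f * sobNormR n p Ω g := by
  obtain ⟨Ext, C, hC, hExt⟩ := hext
  obtain ⟨K, hK, hmul⟩ := exists_sobNormR_mul_le_univ d n hn hp hnp
  refine ⟨K * (C * C), by finiteness, fun f g hf hg => ?_⟩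
  obtain ⟨hf1, hf2⟩ := hExt f hf
  obtain ⟨hg1, hg2⟩ := hExt g hg
  have hle : sobNormR n p Ω (fun x => f x * g x) ≤
      K * (C * C) * sobNormR n p Ω f * sobNormR n p Ω g :=
    calc sobNormR n p Ω (fun x => f x * g x)
        ≤ K * (sobNormR n p univ (Ext f) * sobNormR n p univ (Ext g)) :=
          hmul Ω f g _ _ hf1 hg1 (hf2.trans_lt (ENNReal.mul_lt_top hC.lt_top hf))
            (hg2.trans_lt (ENNReal.mul_lt_top hC.lt_top hg))
      _ ≤ K * (C * sobNormR n p Ω f * (C * sobNormR n p Ω g)) := by gcongr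
      _ = K * (C * C) * sobNormR n p Ω f * sobNormR n p Ω g := by ring
  have hf' := hf.ne
  have hg' := hg.ne
  exact ⟨hle.trans_lt (lt_top_iff_ne_top.2 (by finiteness)), hle⟩

end
end

section
/- Let n, m ∈ ℕ with m ≥ n. There exist nonnegative coefficients c_{j⃗,m}, indexed by vectors j⃗ = (j₁,…,j_n) ∈ ℕ₀ⁿ with j₁ ≥ j₂ ≥ … ≥ j_n and j₁+…+j_n = n, with Σ_{j⃗} c_{j⃗,m} = m^n, such that for every smooth function f on an open subset of ℝ^d one has ∂₁ⁿ(f^m) = f^{m−n} Σ_{j⃗} c_{j⃗,m} ∏_{i=1}^{n} ∂₁^{j_i} f. -/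
open scoped BigOperators

noncomputable section

/-- Partial derivative in the direction `v`. -/
def pdir {d : ℕ} (v : EuclideanSpace ℝ (Fin d))
    (g : EuclideanSpace ℝ (Fin d) → ℝ) : EuclideanSpace ℝ (Fin d) → ℝ :=
  fun y => fderiv ℝ g y v

/-- Sums over a multiset of differentiable functions are differentiable, and `pdir v` commutes
with them. -/
theorem pdir_multiset_sum {d : ℕ} {ι : Type*} (v x : EuclideanSpace ℝ (Fin d))
    (S : Multiset ι) (G : ι → EuclideanSpace ℝ (Fin d) → ℝ)
    (hG : ∀ a, DifferentiableAt ℝ (G a) x) :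
    DifferentiableAt ℝ (fun y => (S.map fun a => G a y).sum) x ∧
      pdir v (fun y => (S.map fun a => G a y).sum) x = (S.map fun a => pdir v (G a) x).sum := by
  induction S using Multiset.induction_on with
  | empty => simp [pdir]
  | cons a S ih =>
    simp only [Multiset.map_cons, Multiset.sum_cons]
    refine ⟨(hG a).add ih.1, ?_⟩
    rw [← ih.2]
    simp only [pdir]
    rw [fderiv_fun_add (hG a) ih.1, add_apply]

/-- Smoothness on an open set is inherited by iterated directional derivatives. -/
theorem ContDiffOn.iterate_pdir {d : ℕ} (v : EuclideanSpace ℝ (Fin d))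
    {U : Set (EuclideanSpace ℝ (Fin d))} (hU : IsOpen U) {f : EuclideanSpace ℝ (Fin d) → ℝ}
    (hf : ContDiffOn ℝ (⊤ : ℕ∞) f U) (k : ℕ) : ContDiffOn ℝ (⊤ : ℕ∞) ((pdir v)^[k] f) U := by
  induction k with
  | zero => exact hf
  | succ k ih =>
    rw [Function.iterate_succ_apply']
    exact (ih.fderiv_of_isOpen hU (by simp)).clm_apply contDiffOn_const

/-- Leibniz rule for a product of iterated directional derivatives of one function. -/
theorem pdir_prod_iterate {d m : ℕ} (v x : EuclideanSpace ℝ (Fin d))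
    {f : EuclideanSpace ℝ (Fin d) → ℝ} (hf : ∀ k, DifferentiableAt ℝ ((pdir v)^[k] f) x)
    (a : Fin m → ℕ) :
    pdir v (fun y => ∏ k, (pdir v)^[a k] f y) x =
      ∑ i, ∏ k, (pdir v)^[Function.update a i (a i + 1) k] f x := by
  rw [pdir, fderiv_finsetProd fun k _ => hf (a k), sum_apply]
  refine Finset.sum_congr rfl fun i _ => ?_
  rw [← Finset.prod_erase_mul _ _ (Finset.mem_univ i), Function.update_self,
    Function.iterate_succ_apply', smul_apply, smul_eq_mul]
  congr 1
  refine Finset.prod_congr rfl fun k hk => ?_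
  rw [Function.update_of_ne (Finset.ne_of_mem_erase hk)]

/-- The `n`-th directional derivative of `f ^ m` is a sum of `m ^ n` products of `m` iterated
derivatives of `f` of total order `n`. -/
theorem exists_iterate_pdir_pow_eq_sum (n m : ℕ) :
    ∃ S : Multiset (Fin m → ℕ), S.card = m ^ n ∧ (∀ a ∈ S, ∑ k, a k = n) ∧
      ∀ (d : ℕ) (v : EuclideanSpace ℝ (Fin d)) (U : Set (EuclideanSpace ℝ (Fin d)))
        (f : EuclideanSpace ℝ (Fin d) → ℝ), IsOpen U → ContDiffOn ℝ (⊤ : ℕ∞) f U → ∀ x ∈ U,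
          (pdir v)^[n] (fun y => f y ^ m) x =
            (S.map fun a => ∏ k, (pdir v)^[a k] f x).sum := by
  induction n with
  | zero => exact ⟨{0}, by simp⟩
  | succ n ih =>
    obtain ⟨S, hcard, hsum, hS⟩ := ih
    refine ⟨S.bind fun a => Finset.univ.val.map fun i => Function.update a i (a i + 1),
      ?_, ?_, ?_⟩
    · simp [Multiset.card_bind, Function.comp_def, hcard, pow_succ]
    · intro b hb
      obtain ⟨a, ha, hb⟩ := Multiset.mem_bind.1 hb
      obtain ⟨i, -, rfl⟩ := Multiset.mem_map.1 hb
      rw [← hsum a ha, Finset.sum_update_of_mem (Finset.mem_univ i),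
        ← Finset.add_sum_erase _ a (Finset.mem_univ i), Finset.sdiff_singleton_eq_erase]
      ring
    · intro d v U f hU hf x hx
      have hd : ∀ k, DifferentiableAt ℝ ((pdir v)^[k] f) x := fun k =>
        ((hf.iterate_pdir v hU k).differentiableOn (by simp)).differentiableAt (hU.mem_nhds hx)
      have heq : (pdir v)^[n] (fun y => f y ^ m) =ᶠ[nhds x]
          fun y => (S.map fun a => ∏ k, (pdir v)^[a k] f y).sum := by
        filter_upwards [hU.mem_nhds hx] with y hy using hS d v U f hU hf y hy
      rw [Function.iterate_succ_apply', pdir, heq.fderiv_eq, ← pdir,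
        (pdir_multiset_sum v x S _ fun a =>
          (HasFDerivAt.finsetProd fun k _ => (hd (a k)).hasFDerivAt).differentiableAt).2]
      simp only [pdir_prod_iterate v x hd, Multiset.map_bind, Multiset.sum_bind,
        Multiset.map_map, Function.comp_def]
      rfl

/-- Sorting a tuple of `m` naturals with sum `n ≤ m` decreasingly, all entries past the first `n`
vanish. -/
theorem exists_antitone_prod_eq {n m : ℕ} (hm : n ≤ m) (a : Fin m → ℕ) (ha : ∑ k, a k = n) :
    ∃ j : Fin n → ℕ, Antitone j ∧ ∑ i, j i = n ∧
      ∀ F : ℕ → ℝ, ∏ k, F (a k) = F 0 ^ (m - n) * ∏ i, F (j i) := by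
  obtain ⟨r, rfl⟩ := Nat.exists_eq_add_of_le hm
  let σ : Equiv.Perm (Fin (n + r)) := Fin.revPerm.trans (Tuple.sort a)
  have hb : Antitone (a ∘ σ) := fun i k hik => Tuple.monotone_sort a (Fin.rev_le_rev.2 hik)
  have hbsum : ∑ k, (a ∘ σ) k = n := (Equiv.sum_comp σ a).trans ha
  have hzero : ∀ k : Fin r, (a ∘ σ) (Fin.natAdd n k) = 0 := by
    intro k
    by_contra hk
    have h1 : ∑ i ∈ Finset.Iic (Fin.natAdd n k), 1 ≤ ∑ i ∈ Finset.Iic (Fin.natAdd n k),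
        (a ∘ σ) i :=
      Finset.sum_le_sum fun i hi =>
        (Nat.one_le_iff_ne_zero.2 hk).trans (hb (Finset.mem_Iic.1 hi))
    have h2 := h1.trans (Finset.sum_le_univ_sum_of_nonneg fun _ => Nat.zero_le _)
    rw [hbsum, Finset.sum_const, Fin.card_Iic] at h2
    simp at h2
  refine ⟨fun i => (a ∘ σ) (Fin.castAdd r i),
    fun i k hik => hb ((Fin.strictMono_castAdd r).monotone hik), ?_, ?_⟩
  · rw [Fin.sum_univ_add] at hbsum
    simpa only [hzero, Finset.sum_const_zero, add_zero] using hbsum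
  · intro F
    rw [← Equiv.prod_comp σ, Fin.prod_univ_add]
    have h (k : Fin r) : F (a (σ (Fin.natAdd n k))) = F 0 := congrArg F (hzero k)
    simp [h, mul_comm]

/-- For `m ≥ n` there are nonnegative coefficients `c_{j⃗,m}`, supported
on decreasing vectors `j⃗ ∈ ℕ₀ⁿ` with `|j⃗| = n` and with total sum `m^n`, such that for
every smooth function `f` on an open subset of `ℝ^d` one has
`∂₁ⁿ(f^m) = f^{m-n} Σ_{j⃗} c_{j⃗,m} Π_i ∂₁^{j_i} f`. -/
theorem pow_deriv_expansion (n m : ℕ) (hn : 1 ≤ n) (hm : n ≤ m) :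
    ∃ c : (Fin n → ℕ) → ℕ,
      (∀ j : Fin n → ℕ, c j ≠ 0 →
        (∀ i i' : Fin n, i ≤ i' → j i' ≤ j i) ∧ (∑ i, j i) = n) ∧
      (∑ j ∈ Fintype.piFinset fun _ : Fin n => Finset.range (n + 1), c j) = m ^ n ∧
      ∀ (d : ℕ) (hd : 0 < d) (U : Set (EuclideanSpace ℝ (Fin d)))
        (f : EuclideanSpace ℝ (Fin d) → ℝ), IsOpen U → ContDiffOn ℝ (⊤ : ℕ∞) f U →
        ∀ x ∈ U,
          (pdir (EuclideanSpace.single (⟨0, hd⟩ : Fin d) 1))^[n] (fun y => f y ^ m) x =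
            f x ^ (m - n) *
              ∑ j ∈ Fintype.piFinset fun _ : Fin n => Finset.range (n + 1),
                (c j : ℝ) * ∏ i : Fin n,
                  (pdir (EuclideanSpace.single (⟨0, hd⟩ : Fin d) 1))^[j i] f x := by
  classical
  obtain ⟨S, hcard, hsum, hS⟩ := exists_iterate_pdir_pow_eq_sum n m
  choose! J hanti hJsum hJprod using fun a (ha : ∑ k, a k = n) => exists_antitone_prod_eq hm a ha
  have hT : ∀ j ∈ S.map J, j ∈ Fintype.piFinset fun _ : Fin n => Finset.range (n + 1) := by
    intro j hj
    obtain ⟨a, ha, rfl⟩ := Multiset.mem_map.1 hj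
    refine Fintype.mem_piFinset.2 fun i => Finset.mem_range_succ_iff.2 ?_
    calc J a i ≤ ∑ i, J a i := Finset.single_le_sum (fun _ _ => Nat.zero_le _) (Finset.mem_univ i)
      _ = n := hJsum a (hsum a ha)
  refine ⟨fun j => (S.map J).count j, ?_, ?_, ?_⟩
  · intro j hj
    obtain ⟨a, ha, rfl⟩ := Multiset.mem_map.1 (Multiset.count_ne_zero.1 hj)
    exact ⟨fun i i' h => hanti a (hsum a ha) h, hJsum a (hsum a ha)⟩
  · rw [Multiset.sum_count_eq_card hT, Multiset.card_map, hcard]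
  · intro d hd U f hU hf x hx
    set v := EuclideanSpace.single (⟨0, hd⟩ : Fin d) (1 : ℝ)
    have hcount := Finset.sum_multiset_map_count (S.map J) fun j => ∏ i, (pdir v)^[j i] f x
    rw [Finset.sum_subset fun j hj => hT j (Multiset.mem_toFinset.1 hj)] at hcount
    · simp only [nsmul_eq_mul] at hcount
      rw [hS d v U f hU hf x hx, ← hcount, Multiset.map_map, ← Multiset.sum_map_mul_left]
      exact congrArg _ (Multiset.map_congr rfl fun a ha =>
        hJprod a (hsum a ha) fun k => (pdir v)^[k] f x)
    · intro j _ hj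
      rw [Multiset.count_eq_zero.2 (mt Multiset.mem_toFinset.2 hj), zero_smul]

end
end

section
/- Let j, i be integers with i ≥ 0 and j + i ≤ −2, and let φ(z) = z^j z̄^i χ_{𝔻^c}(z), where 𝔻^c is the complement of the closed unit disk. Then the Beurling transform of φ is Bφ(z) = [ (j/(i+1)) z^{j−1} z̄^{i+1} − ((j−i−1)/(i+1)) z^{j−i−2} ] χ_{𝔻^c}(z) for almost every z ∈ ℂ; in particular Bφ vanishes on 𝔻. -/
open MeasureTheory Filter Set
open scoped ENNReal NNReal

noncomputable section

/-- The Beurling transform, as a principal value. -/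
def beurling (g : ℂ → ℂ) : ℂ → ℂ := fun z =>
  limUnder (nhdsWithin (0 : ℝ) (Set.Ioi 0)) fun ε =>
    (-1 / (Real.pi : ℂ)) * ∫ w in {w : ℂ | ε < ‖w - z‖}, g w / (z - w) ^ 2

section

open Complex Topology

/-- The real-linear map `h ↦ a h + b h̄`. -/
def wirtingerCLM (a b : ℂ) : ℂ →L[ℝ] ℂ :=
  a • ContinuousLinearMap.id ℝ ℂ + b • (conjCLE : ℂ →L[ℝ] ℂ)

@[simp]
lemma wirtingerCLM_apply (a b h : ℂ) :
    wirtingerCLM a b h = a * h + b * (starRingEnd ℂ) h := by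
  simp [wirtingerCLM]

lemma norm_exp_neg_ofReal_mul_I (θ : ℝ) : ‖exp (-(θ * I))‖ = 1 := by
  rw [← neg_mul, ← ofReal_neg, norm_exp_ofReal_mul_I]

lemma conj_exp_mul_I (θ : ℝ) : (starRingEnd ℂ) (exp (θ * I)) = exp (-(θ * I)) := by
  rw [← exp_conj]; simp

lemma hasDerivAt_comp_circleMap_radius {F : ℂ → ℂ} {a b z : ℂ} {r θ : ℝ}
    (hF : HasFDerivAt F (wirtingerCLM a b) (circleMap z r θ)) :
    HasDerivAt (fun r : ℝ => F (circleMap z r θ))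
      (a * exp (θ * I) + b * exp (-(θ * I))) r := by
  have h : HasDerivAt (fun r : ℝ => circleMap z r θ) (exp (θ * I)) r := by
    simpa [circleMap] using
      ((ofRealCLM.hasDerivAt (x := r)).mul_const (exp (θ * I))).const_add z
  refine (hF.comp_hasDerivAt r h).congr_deriv ?_
  simp [conj_exp_mul_I]

lemma hasDerivAt_comp_circleMap_angle {F : ℂ → ℂ} {a b z : ℂ} {r θ : ℝ}
    (hF : HasFDerivAt F (wirtingerCLM a b) (circleMap z r θ)) :
    HasDerivAt (fun θ : ℝ => F (circleMap z r θ))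
      (r * I * (a * exp (θ * I) - b * exp (-(θ * I)))) θ := by
  have h := hF.comp_hasDerivAt θ (hasDerivAt_circleMap z r θ)
  refine h.congr_deriv ?_
  simp [circleMap, conj_exp_mul_I]
  ring

lemma countable_norm_circleMap_radius (z : ℂ) (θ : ℝ) :
    {r : ℝ | ‖circleMap z r θ‖ = 1}.Countable := by
  let p : Polynomial ℝ := Polynomial.X ^ 2 +
    (Polynomial.C (2 * (z * exp (-(θ * I))).re) * Polynomial.X + Polynomial.C (‖z‖ ^ 2 - 1))
  have hp : p ≠ 0 := by
    refine Polynomial.Monic.ne_zero (Polynomial.monic_X_pow_add ?_)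
    exact Polynomial.degree_linear_lt
  refine ((Polynomial.finite_setOfPred_isRoot hp).subset fun r hr => ?_).countable
  have hr' : ‖circleMap z r θ‖ ^ 2 = 1 := by rw [hr.out]; norm_num
  rw [circleMap, ← normSq_eq_norm_sq, normSq_add, normSq_eq_norm_sq, normSq_eq_norm_sq, norm_mul,
    norm_exp_ofReal_mul_I, map_mul, conj_exp_mul_I, conj_ofReal, mul_left_comm, re_ofReal_mul,
    norm_real, mul_one, Real.norm_eq_abs, sq_abs] at hr'
  simp only [Set.mem_ofPred_eq, Polynomial.IsRoot.def, p, Polynomial.eval_add,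
    Polynomial.eval_mul, Polynomial.eval_pow, Polynomial.eval_X, Polynomial.eval_C]
  linarith

lemma countable_norm_circleMap_angle (z : ℂ) {r : ℝ} (hr : 0 < r) (hr1 : r ≠ 1) :
    {θ : ℝ | ‖circleMap z r θ‖ = 1}.Countable := by
  by_cases hz : z = 0
  · subst hz
    convert Set.countable_empty
    ext θ
    simp [abs_of_pos hr, hr1]
  have hfin : {w : ℂ | ‖w‖ = 1 ∧ ‖w - z‖ = r}.Finite := by
    let p : Polynomial ℂ := Polynomial.C ((starRingEnd ℂ) z) * Polynomial.X ^ 2 +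
      Polynomial.C ((r : ℂ) ^ 2 - 1 - z * (starRingEnd ℂ) z) * Polynomial.X + Polynomial.C z
    have hp : p ≠ 0 := fun h => by
      have := congrArg (Polynomial.eval 0) h
      simp [p, hz] at this
    refine (Polynomial.finite_setOfPred_isRoot hp).subset fun w hw => ?_
    obtain ⟨h1, h2⟩ := hw
    have h1' : w * (starRingEnd ℂ) w = 1 := by rw [mul_conj, normSq_eq_norm_sq, h1]; simp
    have h2' : (w - z) * (starRingEnd ℂ) (w - z) = (r : ℂ) ^ 2 := by
      rw [mul_conj, normSq_eq_norm_sq, h2]; simp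
    rw [map_sub] at h2'
    simp only [Set.mem_ofPred_eq, Polynomial.IsRoot.def, p, Polynomial.eval_add,
      Polynomial.eval_mul, Polynomial.eval_pow, Polynomial.eval_X, Polynomial.eval_C]
    linear_combination (-w) * h2' + (w - z) * h1'
  refine (hfin.countable.preimage_circleMap z hr.ne').mono fun θ hθ => ?_
  exact ⟨hθ, by simp [circleMap, abs_of_pos hr]⟩

lemma integrableOn_Ioi_of_norm_le_rpow {f : ℝ → ℂ} (hf : Measurable f) {ε C : ℝ} (hε : 0 < ε)
    (hb : ∀ r, ε < r → ‖f r‖ ≤ C * r ^ (-2 : ℝ)) : IntegrableOn f (Ioi ε) := by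
  refine ((integrableOn_Ioi_rpow_of_lt (by norm_num : (-2 : ℝ) < -1) hε).const_mul C).mono'
    hf.aestronglyMeasurable ?_
  exact (ae_restrict_iff' measurableSet_Ioi).2 (ae_of_all _ hb)

lemma integrableOn_strip_of_norm_le_rpow {f : ℝ × ℝ → ℂ} (hf : Measurable f) {ε C : ℝ}
    (hε : 0 < ε) (hb : ∀ p : ℝ × ℝ, ε < p.1 → ‖f p‖ ≤ C * p.1 ^ (-2 : ℝ)) :
    IntegrableOn f (Ioi ε ×ˢ Ioc (-Real.pi) Real.pi) (volume.prod volume) := by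
  have h1 : IntegrableOn (fun p : ℝ × ℝ => C * p.1 ^ (-2 : ℝ) * 1)
      (Ioi ε ×ˢ Ioc (-Real.pi) Real.pi) (volume.prod volume) := by
    rw [IntegrableOn, ← Measure.prod_restrict]
    exact ((integrableOn_Ioi_rpow_of_lt (by norm_num : (-2 : ℝ) < -1) hε).const_mul C).mul_prod
      (integrable_const (1 : ℝ))
  refine h1.mono' hf.aestronglyMeasurable ?_
  refine (ae_restrict_iff' (measurableSet_Ioi.prod measurableSet_Ioc)).2 (ae_of_all _ ?_)
  intro p hp
  simpa using hb p hp.1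

/-- The fundamental theorem of calculus on `(ε, ∞)` for a continuous function which tends to zero
at infinity and has an integrable derivative off a countable set. -/
lemma integral_Ioi_of_hasDerivAt_off_countable {f f' : ℝ → ℂ} {ε : ℝ} {s : Set ℝ}
    (hs : s.Countable) (hc : ContinuousOn f (Ici ε))
    (hd : ∀ x ∈ Ioi ε \ s, HasDerivAt f (f' x) x) (hi : IntegrableOn f' (Ioi ε))
    (hlim : Tendsto f atTop (𝓝 0)) : ∫ x in Ioi ε, f' x = -f ε := by
  have h1 := intervalIntegral_tendsto_integral_Ioi ε hi tendsto_id
  have h2 : Tendsto (fun R => f R - f ε) atTop (𝓝 (0 - f ε)) := hlim.sub_const _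
  rw [zero_sub] at h2
  refine tendsto_nhds_unique (h1.congr' ?_) h2
  filter_upwards [eventually_ge_atTop ε] with R hR
  refine integral_eq_of_hasDerivAt_off_countable_of_le f f' hR hs (hc.mono Icc_subset_Ici_self)
    (fun x hx => hd x ⟨hx.1.1, hx.2⟩) ?_
  exact (intervalIntegrable_iff_integrableOn_Ioc_of_le hR).2 (hi.mono_set Ioc_subset_Ioi_self)

lemma integral_exp_neg_mul_I_pow {n : ℕ} (hn : n ≠ 0) :
    ∫ θ in Ioc (-Real.pi) Real.pi, exp (-((θ : ℝ) * I)) ^ n = 0 := by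
  have hpi : -Real.pi ≤ Real.pi := by linarith [Real.pi_pos]
  have h : ∀ θ : ℝ, exp (-(θ * I)) ^ n = exp (-(n * I) * θ) := fun θ => by
    rw [← exp_nat_mul]; ring_nf
  simp only [h]
  rw [← intervalIntegral.integral_of_le hpi, integral_exp_mul_complex (by simpa using hn),
    (exp_eq_exp_iff_exists_int (x := -(n * I) * (Real.pi : ℝ))
      (y := -(n * I) * ((-Real.pi : ℝ) : ℂ))).2
      ⟨-n, by push_cast; ring⟩, sub_self, zero_div]

lemma setIntegral_compl_closedBall_eq_polar (g : ℂ → ℂ) (z : ℂ) {ε : ℝ} (hε : 0 < ε) :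
    ∫ w in {w : ℂ | ε < ‖w - z‖}, g w =
      ∫ p in Ioi ε ×ˢ Ioc (-Real.pi) Real.pi, (p.1 : ℂ) * g (circleMap z p.1 p.2)
        ∂((volume : Measure ℝ).prod (volume : Measure ℝ)) := by
  have hm : MeasurableSet {w : ℂ | ε < ‖w - z‖} :=
    measurableSet_lt measurable_const (by fun_prop)
  rw [← integral_indicator hm, ← integral_add_right_eq_self _ z,
    ← Complex.integral_comp_polarCoord_symm, polarCoord_target]
  have hs : (Ioi ε ×ˢ Ioo (-Real.pi) Real.pi : Set (ℝ × ℝ)) ⊆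
      Ioi 0 ×ˢ Ioo (-Real.pi) Real.pi :=
    prod_mono (Ioi_subset_Ioi hε.le) subset_rfl
  have hae : (Ioi ε ×ˢ Ioc (-Real.pi) Real.pi : Set (ℝ × ℝ)) =ᵐ[volume.prod volume]
      (Ioi ε ×ˢ Ioo (-Real.pi) Real.pi : Set (ℝ × ℝ)) :=
    Measure.set_prod_ae_eq (ae_eq_refl _) Ioo_ae_eq_Ioc.symm
  rw [setIntegral_congr_set hae, ← Measure.volume_eq_prod]
  symm
  have hnorm : ∀ p : ℝ × ℝ, 0 < p.1 → ‖Complex.polarCoord.symm p + z - z‖ = p.1 := fun p hp => by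
    rw [add_sub_cancel_right, norm_polarCoord_symm, abs_of_pos hp]
  rw [setIntegral_eq_of_subset_of_forall_sdiff_eq_zero
    (measurableSet_Ioi.prod measurableSet_Ioo) hs]
  · refine setIntegral_congr_fun (measurableSet_Ioi.prod measurableSet_Ioo) fun p hp => ?_
    have hp0 : ε < p.1 := hp.1
    have hmem : Complex.polarCoord.symm p + z ∈ {w : ℂ | ε < ‖w - z‖} := by
      rw [Set.mem_ofPred_eq, hnorm p (hε.trans hp0)]
      exact hp0
    simp only [indicator_of_mem hmem, real_smul]
    congr 2
    rw [Complex.polarCoord_symm_apply, circleMap, exp_mul_I, ofReal_cos, ofReal_sin, add_comm]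
  · rintro p ⟨hp, hp'⟩
    have hnot : Complex.polarCoord.symm p + z ∉ {w : ℂ | ε < ‖w - z‖} := by
      rw [Set.mem_ofPred_eq, hnorm p hp.1]
      exact fun h => hp' ⟨h, hp.2⟩
    rw [indicator_of_notMem hnot, smul_zero]

lemma setIntegral_truncated_kernel {F a b : ℂ → ℂ} {C : ℝ} (hFc : Continuous F)
    (hF : ∀ w, ‖F w‖ ≤ C) (ham : Measurable a) (hbm : Measurable b)
    (ha : ∀ w, ‖a w‖ ≤ C / (1 + ‖w‖)) (hb : ∀ w, ‖b w‖ ≤ C / (1 + ‖w‖))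
    (hd : ∀ w, ‖w‖ ≠ 1 → HasFDerivAt F (wirtingerCLM (a w) (b w)) w)
    (z : ℂ) {ε : ℝ} (hε : 0 < ε) :
    ∫ w in {w : ℂ | ε < ‖w - z‖}, b w / (z - w) ^ 2 =
      -(1 / 2) * ∫ θ in Ioc (-Real.pi) Real.pi, exp (-(θ * I)) * F (circleMap z ε θ) / ε := by
  have hC : 0 ≤ C := (norm_nonneg _).trans (hF 0)
  have hcm : Measurable fun p : ℝ × ℝ => circleMap z p.1 p.2 := by
    unfold circleMap; fun_prop
  set e : ℝ → ℂ := fun θ => exp (θ * I) with he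
  set e' : ℝ → ℂ := fun θ => exp (-(θ * I)) with he'
  have hem : Measurable e := by fun_prop
  have hem' : Measurable e' := by fun_prop
  have hne : ∀ θ, ‖e θ‖ = 1 := fun θ => norm_exp_ofReal_mul_I θ
  have hne' : ∀ θ, ‖e' θ‖ = 1 := norm_exp_neg_ofReal_mul_I
  have hee : ∀ θ, e θ * e' θ = 1 := fun θ => by simp [he, he', ← exp_add]
  let K₁ : ℝ × ℝ → ℂ := fun p => e' p.2 *
    ((a (circleMap z p.1 p.2) * e p.2 + b (circleMap z p.1 p.2) * e' p.2) / p.1 -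
      F (circleMap z p.1 p.2) / p.1 ^ 2)
  let K₂ : ℝ × ℝ → ℂ := fun p =>
    (e' p.2 * F (circleMap z p.1 p.2) + I * e' p.2 * (p.1 * I *
      (a (circleMap z p.1 p.2) * e p.2 - b (circleMap z p.1 p.2) * e' p.2))) / p.1 ^ 2
  have hFm := hFc.measurable
  have hK₁m : Measurable K₁ := by fun_prop
  have hK₂m : Measurable K₂ := by fun_prop
  have hdecay : ∀ {c : ℂ → ℂ}, (∀ w, ‖c w‖ ≤ C / (1 + ‖w‖)) → ∀ r θ, 0 < r →
      ‖c (circleMap z r θ)‖ ≤ C * (1 + ‖z‖) / r := by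
    intro c hc r θ hr
    refine (hc _).trans ?_
    have h1 : r ≤ ‖circleMap z r θ‖ + ‖z‖ := by
      have : ‖circleMap z r θ - z‖ = r := by simp [circleMap, abs_of_pos hr]
      linarith [norm_sub_le (circleMap z r θ) z]
    rw [div_le_div_iff₀ (by positivity) hr, mul_assoc]
    gcongr
    nlinarith [norm_nonneg z, norm_nonneg (circleMap z r θ)]
  have hpow : ∀ r : ℝ, 0 < r → r ^ (-2 : ℝ) = 1 / r ^ 2 := fun r hr => by
    rw [Real.rpow_neg hr.le, one_div]; norm_cast
  set M : ℝ := 2 * (C * (1 + ‖z‖)) + C with hM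
  have hK₁b : ∀ p : ℝ × ℝ, ε < p.1 → ‖K₁ p‖ ≤ M * p.1 ^ (-2 : ℝ) := by
    rintro ⟨r, θ⟩ hr
    have hr0 : 0 < r := hε.trans hr
    have h1 := hdecay ha r θ hr0
    have h2 := hdecay hb r θ hr0
    have h3 := hF (circleMap z r θ)
    rw [hpow r hr0]
    calc ‖K₁ (r, θ)‖ ≤ (‖a (circleMap z r θ)‖ + ‖b (circleMap z r θ)‖) / r +
          ‖F (circleMap z r θ)‖ / r ^ 2 := by
          simp only [K₁, norm_mul, hne', one_mul]
          refine (norm_sub_le _ _).trans ?_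
          rw [norm_div, norm_div, norm_pow, norm_real, Real.norm_of_nonneg hr0.le]
          gcongr
          refine (norm_add_le _ _).trans ?_
          simp [hne, hne']
      _ ≤ (C * (1 + ‖z‖) / r + C * (1 + ‖z‖) / r) / r + C / r ^ 2 := by gcongr
      _ = M * (1 / r ^ 2) := by rw [hM]; field_simp; ring
  have hK₂b : ∀ p : ℝ × ℝ, ε < p.1 → ‖K₂ p‖ ≤ M * p.1 ^ (-2 : ℝ) := by
    rintro ⟨r, θ⟩ hr
    have hr0 : 0 < r := hε.trans hr
    have h1 := hdecay ha r θ hr0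
    have h2 := hdecay hb r θ hr0
    have h3 := hF (circleMap z r θ)
    rw [hpow r hr0]
    calc ‖K₂ (r, θ)‖ ≤ (‖F (circleMap z r θ)‖ +
          r * (‖a (circleMap z r θ)‖ + ‖b (circleMap z r θ)‖)) / r ^ 2 := by
          simp only [K₂]
          rw [norm_div, norm_pow, norm_real, Real.norm_of_nonneg hr0.le]
          gcongr
          refine (norm_add_le _ _).trans ?_
          simp only [norm_mul, norm_I, hne', one_mul, mul_one, norm_real,
            Real.norm_of_nonneg hr0.le]
          gcongr
          refine (norm_sub_le _ _).trans ?_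
          simp [hne, hne']
      _ ≤ (C + r * (C * (1 + ‖z‖) / r + C * (1 + ‖z‖) / r)) / r ^ 2 := by gcongr
      _ = M * (1 / r ^ 2) := by rw [hM]; field_simp; ring
  have hK₁i := integrableOn_strip_of_norm_le_rpow hK₁m hε hK₁b
  have hK₂i := integrableOn_strip_of_norm_le_rpow hK₂m hε hK₂b
  have hsum : ∀ p ∈ (Ioi ε ×ˢ Ioc (-Real.pi) Real.pi : Set (ℝ × ℝ)),
      (p.1 : ℂ) * (b (circleMap z p.1 p.2) / (z - circleMap z p.1 p.2) ^ 2) =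
        (1 / 2) * (K₁ p + K₂ p) := by
    rintro ⟨r, θ⟩ hp
    have hr0 : (r : ℂ) ≠ 0 := ofReal_ne_zero.2 (hε.trans hp.1).ne'
    have hz : (z - circleMap z r θ) = -(r * e θ) := by simp [circleMap, he]
    have hen : e θ ≠ 0 := exp_ne_zero _
    have he2 : e' θ = (e θ)⁻¹ := eq_inv_of_mul_eq_one_right (hee θ)
    simp only [K₁, K₂, hz, he2]
    field_simp
    ring_nf
    simp only [I_sq]
    ring
  have hint₁ : ∀ θ : ℝ, ∫ r in Ioi ε, K₁ (r, θ) = -(e' θ * F (circleMap z ε θ) / ε) := by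
    intro θ
    refine integral_Ioi_of_hasDerivAt_off_countable (countable_norm_circleMap_radius z θ)
      (f := fun r : ℝ => e' θ * F (circleMap z r θ) / r) ?_ ?_ ?_ ?_
    · refine ContinuousOn.div (by unfold circleMap; fun_prop) (by fun_prop) fun r hr => ?_
      exact ofReal_ne_zero.2 (hε.trans_le hr).ne'
    · rintro r ⟨hr, hr1⟩
      have hr0 : (r : ℂ) ≠ 0 := ofReal_ne_zero.2 (hε.trans hr).ne'
      refine (((hasDerivAt_comp_circleMap_radius (hd _ hr1)).const_mul (e' θ)).div
        (ofRealCLM.hasDerivAt (x := r)) hr0).congr_deriv ?_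
      simp only [K₁, he, he', ofRealCLM_apply, ofReal_one]
      field_simp
    · exact integrableOn_Ioi_of_norm_le_rpow (by fun_prop) hε fun r hr => hK₁b (r, θ) hr
    · refine squeeze_zero_norm' (a := fun r => C / r) ?_ (tendsto_const_nhds.div_atTop tendsto_id)
      filter_upwards [eventually_gt_atTop 0] with r hr
      rw [norm_div, norm_mul, hne', one_mul, norm_real, Real.norm_of_nonneg hr.le]
      gcongr
      exact hF _
  have hint₂ : ∀ r : ℝ, ε < r → r ≠ 1 → ∫ θ in Ioc (-Real.pi) Real.pi, K₂ (r, θ) = 0 := by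
    intro r hr hr1
    have hr0 : 0 < r := hε.trans hr
    have hpi : -Real.pi ≤ Real.pi := by linarith [Real.pi_pos]
    rw [← intervalIntegral.integral_of_le hpi]
    rw [integral_eq_of_hasDerivAt_off_countable_of_le
      (fun θ : ℝ => I * e' θ * F (circleMap z r θ) / r ^ 2) (fun θ => K₂ (r, θ)) hpi
      (countable_norm_circleMap_angle z hr0 hr1)]
    · simp [he', circleMap, exp_neg]
    · exact Continuous.continuousOn (by fun_prop)
    · rintro θ ⟨-, hθ⟩
      have h1 : HasDerivAt (fun θ : ℝ => I * e' θ) (e' θ) θ := by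
        have := ((((ofRealCLM.hasDerivAt (x := θ)).mul_const I).neg).cexp).const_mul I
        refine this.congr_deriv ?_
        simp only [he', ofRealCLM_apply, ofReal_one, one_mul]
        linear_combination -exp (-(θ * I)) * I_sq
      refine ((h1.mul (hasDerivAt_comp_circleMap_angle (hd _ hθ))).div_const _).congr_deriv ?_
      simp only [K₂, he, he']
    · rw [intervalIntegrable_iff_integrableOn_Ioc_of_le hpi]
      refine Integrable.mono' (integrable_const (M * r ^ (-2 : ℝ)))
        (hK₂m.comp measurable_prodMk_left).aestronglyMeasurable
        (ae_of_all _ fun θ => hK₂b (r, θ) hr)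
  rw [setIntegral_compl_closedBall_eq_polar _ z hε,
    setIntegral_congr_fun (measurableSet_Ioi.prod measurableSet_Ioc) hsum,
    integral_const_mul, integral_add hK₁i hK₂i]
  have h2 : ∫ p in Ioi ε ×ˢ Ioc (-Real.pi) Real.pi, K₂ p ∂(volume.prod volume) = 0 := by
    rw [setIntegral_prod _ hK₂i]
    refine integral_eq_zero_of_ae ((ae_restrict_iff' measurableSet_Ioi).2 ?_)
    filter_upwards [Measure.ae_ne volume (1 : ℝ)] with r hr1 hr using hint₂ r hr hr1
  have h1 : ∫ p in Ioi ε ×ˢ Ioc (-Real.pi) Real.pi, K₁ p ∂(volume.prod volume) =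
      -∫ θ in Ioc (-Real.pi) Real.pi, e' θ * F (circleMap z ε θ) / ε := by
    rw [IntegrableOn, ← Measure.prod_restrict] at hK₁i
    rw [← Measure.prod_restrict, integral_prod_symm _ hK₁i, ← integral_neg]
    simp only [hint₁]
  rw [h1, h2]
  ring

/-- If `F` is continuous with Wirtinger derivatives `a = ∂F` and `b = ∂̄F` off the unit circle,
then the Beurling transform of `b` is `a` off the unit circle. -/
lemma tendsto_truncated_beurling {F a b : ℂ → ℂ} {C : ℝ} (hFc : Continuous F)
    (hF : ∀ w, ‖F w‖ ≤ C) (ham : Measurable a) (hbm : Measurable b)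
    (ha : ∀ w, ‖a w‖ ≤ C / (1 + ‖w‖)) (hb : ∀ w, ‖b w‖ ≤ C / (1 + ‖w‖))
    (hd : ∀ w, ‖w‖ ≠ 1 → HasFDerivAt F (wirtingerCLM (a w) (b w)) w)
    {z : ℂ} (hz : ‖z‖ ≠ 1) :
    Tendsto (fun ε : ℝ => (-1 / (Real.pi : ℂ)) *
      ∫ w in {w : ℂ | ε < ‖w - z‖}, b w / (z - w) ^ 2) (𝓝[>] 0) (𝓝 (a z)) := by
  obtain ⟨K, hK⟩ := (hd z hz).isBigO_sub.bound
  have hlim : Tendsto (fun ε : ℝ => ∫ θ in Ioc (-Real.pi) Real.pi,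
      exp (-((θ : ℝ) * I)) * ((F (circleMap z ε θ) - F z) / ε)) (𝓝[>] 0)
      (𝓝 (∫ θ in Ioc (-Real.pi) Real.pi, exp (-((θ : ℝ) * I)) *
        (a z * exp ((θ : ℝ) * I) + b z * exp (-((θ : ℝ) * I))))) := by
    refine tendsto_integral_filter_of_dominated_convergence (fun _ => K) ?_ ?_
      (integrable_const K) ?_
    · refine Eventually.of_forall fun ε => Continuous.aestronglyMeasurable (by fun_prop)
    · obtain ⟨δ, hδ, hball⟩ := Metric.eventually_nhds_iff.1 hK
      filter_upwards [Ioo_mem_nhdsGT hδ] with ε hε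
      refine ae_of_all _ fun θ => ?_
      have hdist : ‖circleMap z ε θ - z‖ = ε := by simp [circleMap, abs_of_pos hε.1]
      have := hball (y := circleMap z ε θ) (by rw [dist_eq_norm, hdist]; exact hε.2)
      rw [hdist] at this
      rw [norm_mul, norm_exp_neg_ofReal_mul_I, one_mul, norm_div, norm_real,
        Real.norm_of_nonneg hε.1.le, div_le_iff₀ hε.1]
      exact this
    · refine ae_of_all _ fun θ => Tendsto.const_mul _ ?_
      have h0 : circleMap z 0 θ = z := by simp
      have h := hasDerivAt_comp_circleMap_radius (r := 0) (θ := θ) (z := z)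
        (a := a z) (b := b z) (F := F) (by rw [h0]; exact hd z hz)
      have h' := (hasDerivAt_iff_tendsto_slope_zero.1 h).mono_left
        (nhdsWithin_mono 0 (fun x (hx : (0:ℝ) < x) => hx.ne'))
      refine h'.congr fun ε => ?_
      simp [div_eq_inv_mul]
  have hval : ∫ θ in Ioc (-Real.pi) Real.pi, exp (-((θ : ℝ) * I)) *
        (a z * exp ((θ : ℝ) * I) + b z * exp (-((θ : ℝ) * I))) = 2 * Real.pi * a z := by
    have : ∀ θ : ℝ, exp (-((θ : ℝ) * I)) *
        (a z * exp ((θ : ℝ) * I) + b z * exp (-((θ : ℝ) * I))) =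
        a z + b z * exp (-((θ : ℝ) * I)) ^ 2 := fun θ => by
      have : exp (-((θ : ℝ) * I)) * exp ((θ : ℝ) * I) = 1 := by simp [← exp_add]
      linear_combination a z * this
    simp only [this]
    rw [integral_add (integrable_const _), integral_const_mul, integral_exp_neg_mul_I_pow two_ne_zero]
    · simp [two_mul, Real.pi_pos.le]
    · exact (Continuous.integrableOn_Icc (by fun_prop)).mono_set Ioc_subset_Icc_self
  rw [hval] at hlim
  have hpi0 : (Real.pi : ℂ) ≠ 0 := ofReal_ne_zero.2 Real.pi_ne_zero
  have hfin := hlim.const_mul (1 / (2 * (Real.pi : ℂ)))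
  have : (1 / (2 * (Real.pi : ℂ))) * (2 * Real.pi * a z) = a z := by field_simp
  rw [this] at hfin
  refine hfin.congr' ?_
  filter_upwards [self_mem_nhdsWithin] with ε hε
  rw [setIntegral_truncated_kernel hFc hF ham hbm ha hb hd z hε]
  have hzero : ∫ θ in Ioc (-Real.pi) Real.pi, exp (-((θ : ℝ) * I)) = 0 := by
    simpa using integral_exp_neg_mul_I_pow one_ne_zero
  have hsplit : ∀ θ : ℝ, exp (-((θ : ℝ) * I)) * ((F (circleMap z ε θ) - F z) / ε) =
      exp (-((θ : ℝ) * I)) * F (circleMap z ε θ) / ε - exp (-((θ : ℝ) * I)) * (F z / ε) :=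
    fun θ => by ring
  simp only [hsplit]
  rw [integral_sub, integral_mul_const, hzero, zero_mul, sub_zero]
  · rw [← mul_assoc]
    congr 1
    field_simp
  · exact (Continuous.integrableOn_Icc (by fun_prop)).mono_set Ioc_subset_Icc_self
  · exact (Continuous.integrableOn_Icc (by fun_prop)).mono_set Ioc_subset_Icc_self

lemma hasFDerivAt_zpow_real (m : ℤ) {w : ℂ} (hw : w ≠ 0) :
    HasFDerivAt (fun w : ℂ => w ^ m) (wirtingerCLM (m * w ^ (m - 1)) 0) w := by
  refine ((hasDerivAt_zpow m w (Or.inl hw)).hasFDerivAt.restrictScalars ℝ).congr_fderiv ?_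
  ext h
  simp [mul_comm]

lemma hasFDerivAt_conj_zpow (m : ℤ) {w : ℂ} (hw : w ≠ 0) :
    HasFDerivAt (fun w : ℂ => (starRingEnd ℂ) w ^ m)
      (wirtingerCLM 0 (m * (starRingEnd ℂ) w ^ (m - 1))) w := by
  have hw' : (starRingEnd ℂ) w ≠ 0 := by simpa using hw
  refine ((hasFDerivAt_zpow_real m hw').comp w conjCLE.hasFDerivAt).congr_fderiv ?_
  ext h
  simp

/-- The continuous function, vanishing on the closed unit disk, whose Wirtinger derivatives
outside the disk are computed in `hasFDerivAt_monomialPrimitive`. -/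
def monomialPrimitive (j i : ℤ) (w : ℂ) : ℂ :=
  if 1 < ‖w‖ then (w ^ j * (starRingEnd ℂ) w ^ (i + 1) - w ^ (j - i - 1)) / (i + 1) else 0

/-- The holomorphic derivative of `monomialPrimitive` off the unit circle. -/
def monomialBeurling (j i : ℤ) (z : ℂ) : ℂ :=
  if 1 < ‖z‖ then
    ((j : ℂ) / ((i : ℂ) + 1)) * z ^ (j - 1) * ((starRingEnd ℂ) z) ^ (i + 1) -
      (((j : ℂ) - (i : ℂ) - 1) / ((i : ℂ) + 1)) * z ^ (j - i - 2)
  else 0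

lemma continuousAt_zpow_mul_conj_zpow (j i : ℤ) {w : ℂ} (hw : w ≠ 0) :
    ContinuousAt (fun w : ℂ =>
      (w ^ j * (starRingEnd ℂ) w ^ (i + 1) - w ^ (j - i - 1)) / ((i : ℂ) + 1)) w :=
  (((hasFDerivAt_zpow_real j hw).continuousAt.mul
    (hasFDerivAt_conj_zpow (i + 1) hw).continuousAt).sub
    (hasFDerivAt_zpow_real (j - i - 1) hw).continuousAt).div_const _

lemma continuous_monomialPrimitive (j i : ℤ) : Continuous (monomialPrimitive j i) := by
  rw [continuous_iff_continuousAt]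
  intro w
  rcases lt_trichotomy ‖w‖ 1 with hw | hw | hw
  · refine (continuousAt_const (y := (0 : ℂ))).congr ?_
    filter_upwards [continuous_norm.continuousAt.eventually_lt_const hw] with v hv
    simp [monomialPrimitive, hv.not_gt]
  · have hw0 : w ≠ 0 := norm_ne_zero_iff.1 (by rw [hw]; exact one_ne_zero)
    have hconj : (starRingEnd ℂ) w = w⁻¹ := by
      refine eq_inv_of_mul_eq_one_right ?_
      rw [mul_conj, normSq_eq_norm_sq, hw]; simp
    have hval : (w ^ j * (starRingEnd ℂ) w ^ (i + 1) - w ^ (j - i - 1)) / ((i : ℂ) + 1) = 0 := by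
      rw [hconj, inv_zpow', ← zpow_add₀ hw0, show j + -(i + 1) = j - i - 1 by ring]; simp
    have hlim := (continuousAt_zpow_mul_conj_zpow j i hw0).norm.tendsto
    rw [hval, norm_zero] at hlim
    have h0 : monomialPrimitive j i w = 0 := by simp [monomialPrimitive, hw]
    rw [ContinuousAt, h0]
    refine squeeze_zero_norm (fun v => ?_) hlim
    unfold monomialPrimitive
    split_ifs
    · exact le_rfl
    · rw [norm_zero]
      exact norm_nonneg _
  · have hw0 : w ≠ 0 := norm_pos_iff.1 (one_pos.trans hw)
    refine (continuousAt_zpow_mul_conj_zpow j i hw0).congr ?_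
    filter_upwards [continuous_norm.continuousAt.eventually_const_lt hw] with v hv
    simp [monomialPrimitive, hv]

lemma hasFDerivAt_monomialPrimitive {j i : ℤ} (hi : 0 ≤ i) {w : ℂ} (hw : ‖w‖ ≠ 1) :
    HasFDerivAt (monomialPrimitive j i) (wirtingerCLM (monomialBeurling j i w)
      (if 1 < ‖w‖ then w ^ j * (starRingEnd ℂ) w ^ i else 0)) w := by
  rcases hw.lt_or_gt with hw | hw
  · have h : HasFDerivAt (fun _ : ℂ => (0 : ℂ)) (0 : ℂ →L[ℝ] ℂ) w := hasFDerivAt_const _ _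
    refine (h.congr_of_eventuallyEq ?_).congr_fderiv ?_
    · filter_upwards [continuous_norm.continuousAt.eventually_lt_const hw] with v hv
      simp [monomialPrimitive, hv.not_gt]
    · ext
      simp [monomialBeurling, hw.not_gt]
  · have hw0 : w ≠ 0 := norm_pos_iff.1 (one_pos.trans hw)
    have hi' : (i : ℂ) + 1 ≠ 0 := by exact_mod_cast (by lia : i + 1 ≠ 0)
    have h := (((hasFDerivAt_zpow_real j hw0).mul (hasFDerivAt_conj_zpow (i + 1) hw0)).sub
      (hasFDerivAt_zpow_real (j - i - 1) hw0)).mul_const ((i : ℂ) + 1)⁻¹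
    refine (h.congr_of_eventuallyEq ?_).congr_fderiv ?_
    · filter_upwards [continuous_norm.continuousAt.eventually_const_lt hw] with v hv
      simp [monomialPrimitive, hv, div_eq_mul_inv]
    · refine ContinuousLinearMap.ext fun v => ?_
      simp only [monomialBeurling, hw, if_true, add_sub_cancel_right, wirtingerCLM_apply,
        _root_.smul_apply, _root_.sub_apply,
        _root_.add_apply, smul_eq_mul, Int.cast_sub, Int.cast_add, Int.cast_one,
        show j - i - 1 - 1 = j - i - 2 by ring]
      field_simp
      ring

lemma norm_zpow_mul_conj_zpow_le {m n k : ℤ} (h : m + n ≤ k) {w : ℂ} (hw : 1 < ‖w‖) :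
    ‖w ^ m * (starRingEnd ℂ) w ^ n‖ ≤ ‖w‖ ^ k := by
  rw [norm_mul, norm_zpow, norm_zpow, RCLike.norm_conj, ← zpow_add₀ (one_pos.trans hw).ne']
  exact zpow_le_zpow_right₀ hw.le h

lemma norm_zpow_neg_one_le {w : ℂ} (hw : 1 < ‖w‖) : ‖w‖ ^ (-1 : ℤ) ≤ 2 / (1 + ‖w‖) := by
  rw [zpow_neg_one, inv_eq_one_div, div_le_div_iff₀ (by linarith) (by linarith)]
  linarith

lemma tendsto_truncated_beurling_monomial {j i : ℤ} (hi : 0 ≤ i) (hji : j + i ≤ -2) {z : ℂ}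
    (hz : ‖z‖ ≠ 1) :
    Tendsto (fun ε : ℝ => (-1 / (Real.pi : ℂ)) * ∫ w in {w : ℂ | ε < ‖w - z‖},
      (if 1 < ‖w‖ then w ^ j * (starRingEnd ℂ) w ^ i else 0) / (z - w) ^ 2) (𝓝[>] 0)
      (𝓝 (monomialBeurling j i z)) := by
  have hconj : Measurable fun w : ℂ => (starRingEnd ℂ) w := continuous_conj.measurable
  have hS : MeasurableSet {w : ℂ | 1 < ‖w‖} := measurableSet_lt measurable_const measurable_norm
  set A : ℝ := ‖(j : ℂ) / ((i : ℂ) + 1)‖ with hA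
  set B : ℝ := ‖((j : ℂ) - (i : ℂ) - 1) / ((i : ℂ) + 1)‖ with hB
  set D : ℝ := ‖(i : ℂ) + 1‖⁻¹ with hD
  have hA0 : 0 ≤ A := norm_nonneg _
  have hB0 : 0 ≤ B := norm_nonneg _
  have hD0 : 0 ≤ D := inv_nonneg.2 (norm_nonneg _)
  have hC : 0 ≤ 2 * (A + B + D + 1) := by positivity
  refine tendsto_truncated_beurling (C := 2 * (A + B + D + 1)) (continuous_monomialPrimitive j i)
    (fun w => ?_) (a := monomialBeurling j i) ?_ ?_ (fun w => ?_) (fun w => ?_)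
    (fun w => hasFDerivAt_monomialPrimitive hi) hz
  · unfold monomialPrimitive
    split_ifs with hw
    · have h1 := norm_zpow_mul_conj_zpow_le (m := j) (n := i + 1) (k := 0) (by lia) hw
      have h2 := norm_zpow_mul_conj_zpow_le (m := j - i - 1) (n := 0) (k := 0) (by lia) hw
      rw [zpow_zero] at h1 h2
      rw [zpow_zero, mul_one] at h2
      rw [norm_div, div_eq_mul_inv, ← hD]
      calc _ ≤ (1 + 1) * D := by
            gcongr
            exact (norm_sub_le _ _).trans (add_le_add h1 h2)
        _ ≤ _ := by linarith
    · simpa using hC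
  · exact Measurable.ite hS (by fun_prop) measurable_const
  · exact Measurable.ite hS (by fun_prop) measurable_const
  · unfold monomialBeurling
    split_ifs with hw
    · have h1 := norm_zpow_mul_conj_zpow_le (m := j - 1) (n := i + 1) (k := -1) (by lia) hw
      have h2 := norm_zpow_mul_conj_zpow_le (m := j - i - 2) (n := 0) (k := -1) (by lia) hw
      rw [zpow_zero, mul_one] at h2
      have h3 := norm_zpow_neg_one_le hw
      rw [mul_assoc]
      refine (norm_sub_le _ _).trans ?_
      rw [norm_mul (_ / _), norm_mul (_ / _) (w ^ (j - i - 2)), ← hA, ← hB]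
      calc _ ≤ A * (2 / (1 + ‖w‖)) + B * (2 / (1 + ‖w‖)) := by
            gcongr
            · exact h1.trans h3
            · exact h2.trans h3
        _ = 2 * (A + B) / (1 + ‖w‖) := by ring
        _ ≤ _ := div_le_div_of_nonneg_right (by linarith) (by positivity)
    · rw [norm_zero]; positivity
  · split_ifs with hw
    · refine (norm_zpow_mul_conj_zpow_le (k := -1) (by lia) hw).trans
        ((norm_zpow_neg_one_le hw).trans ?_)
      exact div_le_div_of_nonneg_right (by linarith) (by positivity)
    · rw [norm_zero]; positivity

end

/-- For integers `i ≥ 0` and `j + i ≤ -2`, the Beurling transform of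
`φ(z) = z^j z̄^i χ_{𝔻ᶜ}(z)` is
`Bφ(z) = ((j/(i+1)) z^{j-1} z̄^{i+1} - ((j-i-1)/(i+1)) z^{j-i-2}) χ_{𝔻ᶜ}(z)` a.e.;
in particular `Bφ` vanishes on the unit disk `𝔻`. -/
theorem beurling_of_monomial
    (j i : ℤ) (hi : 0 ≤ i) (hji : j + i ≤ -2) :
    (∀ᵐ z : ℂ,
      beurling (fun w => if 1 < ‖w‖ then w ^ j * ((starRingEnd ℂ) w) ^ i else 0) z =
        if 1 < ‖z‖ then
          ((j : ℂ) / ((i : ℂ) + 1)) * z ^ (j - 1) * ((starRingEnd ℂ) z) ^ (i + 1) -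
            (((j : ℂ) - (i : ℂ) - 1) / ((i : ℂ) + 1)) * z ^ (j - i - 2)
        else 0) ∧
    ∀ z ∈ Metric.ball (0 : ℂ) 1,
      beurling (fun w => if 1 < ‖w‖ then w ^ j * ((starRingEnd ℂ) w) ^ i else 0) z = 0 := by
  have key : ∀ z : ℂ, ‖z‖ ≠ 1 →
      beurling (fun w => if 1 < ‖w‖ then w ^ j * ((starRingEnd ℂ) w) ^ i else 0) z =
        monomialBeurling j i z :=
    fun z hz => (tendsto_truncated_beurling_monomial hi hji hz).limUnder_eq
  refine ⟨?_, fun z hz => ?_⟩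
  · have hsphere : ∀ᵐ z : ℂ, z ∉ Metric.sphere (0 : ℂ) 1 :=
      measure_eq_zero_iff_ae_notMem.1 (Measure.addHaar_sphere volume 0 1)
    filter_upwards [hsphere] with z hz
    exact key z (by simpa using hz)
  · have hz1 : ‖z‖ < 1 := by simpa using hz
    rw [key z hz1.ne]
    simp [monomialBeurling, hz1.not_gt]

end
end
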